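/- arXiv:2410.00636 — 3 statements merged into one kernel-verified Lean document; each statement's English description precedes it below -/
import Mathlib

section
/- For all B ≥ 2 there exists C(B) > 0 such that if (d₁, ν₁) and (d₂, ν₂) satisfy ν₁/(1−|d₁|), ν₂/(1−|d₂|) ∈ [−1+1/B, B], then ‖κ*(d₁,ν₁) − κ*(d₂,ν₂)‖_𝓗 ≤ C(B)(|ν₁/(1−|d₁|) − ν₂/(1−|d₂|)| + |arctanh d₁ − arctanh d₂|). -/
noncomputable section

open Real MeasureTheory Set Filter Asymptotics

/-- The weight `ρ(y) = (1-y²)^{2/(p-1)}`. -/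
def rho (p y : ℝ) : ℝ := (1 - y ^ 2) ^ ((2 : ℝ) / (p - 1))

/-- `κ₀ = (2(p+1)/(p-1)²)^{1/(p-1)}`. -/
def kappa0 (p : ℝ) : ℝ := (2 * (p + 1) / (p - 1) ^ 2) ^ ((1 : ℝ) / (p - 1))

/-- The soliton `κ(d,y) = κ₀((1-d²)/(1+dy)²)^{1/(p-1)}`. -/
def kappaSol (p d y : ℝ) : ℝ :=
  kappa0 p * ((1 - d ^ 2) / (1 + d * y) ^ 2) ^ ((1 : ℝ) / (p - 1))

/-- First component of the generalized soliton `κ*`. -/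
def kappaStar1 (p d ν y : ℝ) : ℝ :=
  kappa0 p * (1 - d ^ 2) ^ ((1 : ℝ) / (p - 1)) / (1 + d * y + ν) ^ ((2 : ℝ) / (p - 1))

/-- Second component of the generalized soliton `κ*`. -/
def kappaStar2 (p d ν y : ℝ) : ℝ :=
  -(2 * kappa0 p * ν / (p - 1)) * (1 - d ^ 2) ^ ((1 : ℝ) / (p - 1)) /
    (1 + d * y + ν) ^ ((p + 1) / (p - 1))

/-- The generalized soliton as a pair of functions of `y`. -/
def kappaStarPair (p d ν : ℝ) : (ℝ → ℝ) × (ℝ → ℝ) :=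
  (fun y => kappaStar1 p d ν y, fun y => kappaStar2 p d ν y)

/-- Difference of pairs of functions. -/
def pairSub (v w : (ℝ → ℝ) × (ℝ → ℝ)) : (ℝ → ℝ) × (ℝ → ℝ) :=
  (fun y => v.1 y - w.1 y, fun y => v.2 y - w.2 y)

/-- Squared `𝓗` norm. -/
def HnormSq (p : ℝ) (q : (ℝ → ℝ) × (ℝ → ℝ)) : ℝ :=
  ∫ y in (-1 : ℝ)..1, (q.1 y ^ 2 + (deriv q.1 y) ^ 2 * (1 - y ^ 2) + q.2 y ^ 2) * rho p y

/-- `𝓗` norm. -/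
def Hnorm (p : ℝ) (q : (ℝ → ℝ) × (ℝ → ℝ)) : ℝ := Real.sqrt (HnormSq p q)

/-- Membership in `𝓗` (finiteness of the norm, i.e. integrability of the integrand). -/
def memH (p : ℝ) (q : (ℝ → ℝ) × (ℝ → ℝ)) : Prop :=
  IntervalIntegrable
    (fun y => (q.1 y ^ 2 + (deriv q.1 y) ^ 2 * (1 - y ^ 2) + q.2 y ^ 2) * rho p y)
    volume (-1) 1

/-- Squared `𝓗₀` norm. -/
def H0normSq (p : ℝ) (h : ℝ → ℝ) : ℝ :=
  ∫ y in (-1 : ℝ)..1, (h y ^ 2 + (deriv h y) ^ 2 * (1 - y ^ 2)) * rho p y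

/-- Membership in `𝓗₀`. -/
def memH0 (p : ℝ) (h : ℝ → ℝ) : Prop :=
  IntervalIntegrable (fun y => (h y ^ 2 + (deriv h y) ^ 2 * (1 - y ^ 2)) * rho p y)
    volume (-1) 1

/-- The operator `𝓛 f = ρ⁻¹ ∂_y(ρ (1-y²) ∂_y f)`. -/
def Lop (p : ℝ) (f : ℝ → ℝ) (y : ℝ) : ℝ :=
  (1 / rho p y) * deriv (fun z => rho p z * (1 - z ^ 2) * deriv f z) y

/-- The similarity-variables equation (with the radial correction term) at `(y,s)`. -/
def SolvesSimEq (p : ℝ) (N : ℕ) (r0 : ℝ) (w : ℝ → ℝ → ℝ) (y s : ℝ) : Prop :=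
  deriv (fun s' => deriv (fun s'' => w y s'') s') s =
    Lop p (fun z => w z s) y - 2 * (p + 1) / (p - 1) ^ 2 * w y s +
      |w y s| ^ (p - 1) * w y s - (p + 3) / (p - 1) * deriv (fun s' => w y s') s -
      2 * y * deriv (fun z => deriv (fun s' => w z s') s) y +
      Real.exp (-s) * ((N : ℝ) - 1) / (r0 + y * Real.exp (-s)) *
        deriv (fun z => w z s) y

/-- The radial semilinear wave equation at `(r,t)`. -/
def SolvesRadial (p : ℝ) (N : ℕ) (u : ℝ → ℝ → ℝ) (r t : ℝ) : Prop :=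
  deriv (fun t' => deriv (fun t'' => u r t'') t') t =
    deriv (fun r' => deriv (fun r'' => u r'' t) r') r +
      ((N : ℝ) - 1) / r * deriv (fun r' => u r' t) r + |u r t| ^ (p - 1) * u r t

/-- The explicit solutions `û(d,ν,r₀,T,r,t)`. -/
def uhat (p d ν r0 T r t : ℝ) : ℝ :=
  kappa0 p * (1 - d ^ 2) ^ ((1 : ℝ) / (p - 1)) /
    ((1 + ν) * (T - t) + d * (r - r0)) ^ ((2 : ℝ) / (p - 1))

/-- Similarity variables: `w_{r₀,T₀}(y,s) = (T₀-t)^{2/(p-1)} u(r,t)` with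
`r = r₀ + y e^{-s}`, `t = T₀ - e^{-s}`. -/
def simVar (p r0 T0 : ℝ) (u : ℝ → ℝ → ℝ) (y s : ℝ) : ℝ :=
  Real.exp (-s) ^ ((2 : ℝ) / (p - 1)) * u (r0 + y * Real.exp (-s)) (T0 - Real.exp (-s))

/-- The pair `(w_{r₀,T₀}(s), ∂ₛ w_{r₀,T₀}(s))`. -/
def wpair (p r0 T0 : ℝ) (u : ℝ → ℝ → ℝ) (s : ℝ) : (ℝ → ℝ) × (ℝ → ℝ) :=
  (fun y => simVar p r0 T0 u y s, fun y => deriv (fun s' => simVar p r0 T0 u y s') s)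

/-- Squared unweighted `H¹ × L²(-1,1)` norm. -/
def H1L2normSq (q : (ℝ → ℝ) × (ℝ → ℝ)) : ℝ :=
  ∫ y in (-1 : ℝ)..1, (q.1 y ^ 2 + (deriv q.1 y) ^ 2 + q.2 y ^ 2)

/-- `arg tanh x = ½ log((1+x)/(1-x))`. -/
def arctanhR (x : ℝ) : ℝ := (1 / 2) * Real.log ((1 + x) / (1 - x))

/-- The inner product `φ` of the space `𝓗`. -/
def phiInner (p : ℝ) (q r : (ℝ → ℝ) × (ℝ → ℝ)) : ℝ :=
  ∫ y in (-1 : ℝ)..1,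
    (q.1 y * r.1 y + deriv q.1 y * deriv r.1 y * (1 - y ^ 2) + q.2 y * r.2 y) * rho p y

/-- The normalizing constants `c_λ`. -/
def clamConst (p : ℝ) (lam : ℕ) : ℝ :=
  (2 * ((lam : ℝ) + 2 / (p - 1)) *
    ∫ y in (-1 : ℝ)..1, (y ^ 2 / (1 - y ^ 2)) ^ ((1 : ℝ) - (lam : ℝ)) * rho p y)⁻¹

/-- `c_λ(d) = c_λ (1-d²)^{1/(p-1)}`. -/
def clam (p : ℝ) (lam : ℕ) (d : ℝ) : ℝ := clamConst p lam * (1 - d ^ 2) ^ ((1 : ℝ) / (p - 1))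

/-- Second components `W^d_{λ,2}` of the nonnegative directions. -/
def Wlam2 (p : ℝ) (lam : ℕ) (d y : ℝ) : ℝ :=
  if lam = 1 then clam p 1 d * (1 - y ^ 2) / (1 + d * y) ^ ((2 : ℝ) / (p - 1) + 1)
  else clam p 0 d * (y + d) / (1 + d * y) ^ ((2 : ℝ) / (p - 1) + 1)

/-- The defining property of the first component `W^d_{λ,1}`. -/
def IsW1 (p : ℝ) (lam : ℕ) (d : ℝ) (r : ℝ → ℝ) : Prop :=
  (∀ y ∈ Set.Ioo (-1 : ℝ) 1,
    -Lop p r y + r y = ((lam : ℝ) - (p + 3) / (p - 1)) * Wlam2 p lam d y -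
      2 * y * deriv (fun z => Wlam2 p lam d z) y +
      8 / (p - 1) * Wlam2 p lam d y / (1 - y ^ 2)) ∧
  memH p (r, fun y => Wlam2 p lam d y)

/-- The projections `π^d_λ(v) = φ(W^d_λ, v)`, relative to a family `W1` of
first components `W^d_{λ,1}`. -/
def projH (p : ℝ) (W1 : ℕ → ℝ → ℝ → ℝ) (lam : ℕ) (d : ℝ)
    (v : (ℝ → ℝ) × (ℝ → ℝ)) : ℝ :=
  phiInner p (fun y => W1 lam d y, fun y => Wlam2 p lam d y) v

/-- The potential `ψ_{d,ν}`. -/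
def psiFun (p d ν y : ℝ) : ℝ :=
  p * kappaStar1 p d ν y ^ (p - 1) - 2 * (p + 1) / (p - 1) ^ 2

/-- The quadratic form `φ_{d,ν}(q,q)`. -/
def phiForm (p d ν : ℝ) (q : (ℝ → ℝ) × (ℝ → ℝ)) : ℝ :=
  ∫ y in (-1 : ℝ)..1,
    ((deriv q.1 y) ^ 2 * (1 - y ^ 2) - psiFun p d ν y * q.1 y ^ 2 + q.2 y ^ 2) * rho p y

/-- The nonlinear remainder `f_{d,ν}(q₁)`. -/
def fSmall (p d ν y x : ℝ) : ℝ :=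
  |kappaStar1 p d ν y + x| ^ (p - 1) * (kappaStar1 p d ν y + x) -
    kappaStar1 p d ν y ^ p - p * kappaStar1 p d ν y ^ (p - 1) * x

/-- `𝓕_{ν,d}(x) = ∫₀ˣ f_{ν,d}(ξ) dξ`. -/
def FBig (p d ν y x : ℝ) : ℝ := ∫ ξ in (0 : ℝ)..x, fSmall p d ν y ξ

/-- `R = -∫ 𝓕_{ν,d}(q₁) dy`. -/
def Rfun (p d ν : ℝ) (q : (ℝ → ℝ) × (ℝ → ℝ)) : ℝ :=
  -∫ y in (-1 : ℝ)..1, FBig p d ν y (q.1 y)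

/-- `λ(d,ν) = (1-d²)^{1/(p-1)}/((1+ν)²-d²)^{1/(p-1)}`. -/
def lamFun (p d ν : ℝ) : ℝ :=
  (1 - d ^ 2) ^ ((1 : ℝ) / (p - 1)) / ((1 + ν) ^ 2 - d ^ 2) ^ ((1 : ℝ) / (p - 1))


/-- The Lorentz factor `cosh ξ + y sinh ξ`; it equals `(1 + d y) / √(1 - d²)` for `d = tanh ξ`. -/
def boostFactor (ξ y : ℝ) : ℝ := cosh ξ + y * sinh ξ

/-- The denominator of the generalized soliton in the variables `d = tanh ξ`, `ν = μ (1 - |d|)`. -/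
def solitonDenom (ξ μ y : ℝ) : ℝ := boostFactor ξ y + μ * exp (-|ξ|)

lemma hasDerivAt_boostFactor (ξ y : ℝ) : HasDerivAt (boostFactor ξ) (sinh ξ) y := by
  have h : HasDerivAt (fun z => cosh ξ + z * sinh ξ) (sinh ξ) y := by
    simpa using ((hasDerivAt_id y).mul_const (sinh ξ)).const_add (cosh ξ)
  exact h

lemma hasDerivAt_solitonDenom (ξ μ y : ℝ) : HasDerivAt (solitonDenom ξ μ) (sinh ξ) y :=
  (hasDerivAt_boostFactor ξ y).add_const _

lemma cosh_sub_abs_sinh (ξ : ℝ) : cosh ξ - |sinh ξ| = exp (-|ξ|) := by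
  rw [abs_sinh, ← cosh_abs, cosh_sub_sinh]

lemma neg_abs_mul_abs_sinh_le (y ξ : ℝ) :
    -(|y| * |sinh ξ|) ≤ y * sinh ξ := by
  rw [← abs_mul]
  exact neg_abs_le _

lemma exp_neg_abs_le_boostFactor {y : ℝ} (hy : y ∈ Ioo (-1 : ℝ) 1) (ξ : ℝ) :
    exp (-|ξ|) ≤ boostFactor ξ y := by
  have h := neg_abs_mul_abs_sinh_le y ξ
  have hy' : |y| ≤ 1 := (abs_lt.2 hy).le
  have := cosh_sub_abs_sinh ξ
  unfold boostFactor
  nlinarith [abs_nonneg (sinh ξ)]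

lemma boostFactor_pos {y : ℝ} (hy : y ∈ Ioo (-1 : ℝ) 1) (ξ : ℝ) : 0 < boostFactor ξ y :=
  (exp_pos _).trans_le (exp_neg_abs_le_boostFactor hy ξ)

lemma cosh_mul_one_sub_sq_le {y : ℝ} (hy : y ∈ Ioo (-1 : ℝ) 1) (ξ : ℝ) :
    cosh ξ * (1 - y ^ 2) ≤ 2 * boostFactor ξ y := by
  have h := neg_abs_mul_abs_sinh_le y ξ
  have hy' : |y| ≤ 1 := (abs_lt.2 hy).le
  have h1 : |sinh ξ| ≤ cosh ξ := by
    have := cosh_sub_abs_sinh ξ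
    linarith [exp_pos (-|ξ|)]
  have h2 : cosh ξ * (1 - |y|) ≤ boostFactor ξ y := by
    unfold boostFactor
    nlinarith [mul_le_mul_of_nonneg_left h1 (abs_nonneg y)]
  have h3 : 1 - y ^ 2 ≤ 2 * (1 - |y|) := by
    rw [← sq_abs]
    nlinarith [sq_nonneg (1 - |y|)]
  nlinarith [mul_le_mul_of_nonneg_left h3 (cosh_pos ξ).le]

lemma boostFactor_le_mul_solitonDenom {B y μ : ℝ} (hB : 2 ≤ B) (hy : y ∈ Ioo (-1 : ℝ) 1)
    (hμ : -1 + 1 / B ≤ μ) (ξ : ℝ) : boostFactor ξ y ≤ B * solitonDenom ξ μ y := by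
  have h := exp_neg_abs_le_boostFactor hy ξ
  have hB0 : 0 < B := by linarith
  have h1 : -B + 1 ≤ B * μ := by
    have := mul_le_mul_of_nonneg_left hμ hB0.le
    have h2 : B * (-1 + 1 / B) = -B + 1 := by field_simp
    linarith
  unfold solitonDenom
  nlinarith [exp_pos (-|ξ|), mul_le_mul_of_nonneg_right h1 (exp_pos (-|ξ|)).le]

lemma solitonDenom_pos {B y μ : ℝ} (hB : 2 ≤ B) (hy : y ∈ Ioo (-1 : ℝ) 1)
    (hμ : -1 + 1 / B ≤ μ) (ξ : ℝ) : 0 < solitonDenom ξ μ y := by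
  have h := boostFactor_le_mul_solitonDenom hB hy hμ ξ
  have := boostFactor_pos hy ξ
  nlinarith

lemma solitonDenom_rpow_neg_le {B y μ s : ℝ} (hB : 2 ≤ B) (hy : y ∈ Ioo (-1 : ℝ) 1)
    (hμ : -1 + 1 / B ≤ μ) (hs : 0 ≤ s) (ξ : ℝ) :
    solitonDenom ξ μ y ^ (-s) ≤ B ^ s * boostFactor ξ y ^ (-s) := by
  have hD := solitonDenom_pos hB hy hμ ξ
  have hB0 : 0 < B := by linarith
  have h := rpow_le_rpow_of_nonpos (boostFactor_pos hy ξ)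
    (boostFactor_le_mul_solitonDenom hB hy hμ ξ) (neg_nonpos.2 hs)
  rw [mul_rpow hB0.le hD.le, rpow_neg hB0.le] at h
  have hBs : 0 < B ^ s := rpow_pos_of_pos hB0 s
  calc solitonDenom ξ μ y ^ (-s) = B ^ s * ((B ^ s)⁻¹ * solitonDenom ξ μ y ^ (-s)) := by
        field_simp
    _ ≤ _ := by gcongr

/-! ### Relative Lipschitz estimates -/

lemma abs_exp_sub_exp_le (a b : ℝ) : |exp a - exp b| ≤ |a - b| * (exp a + exp b) := by
  wlog h : b ≤ a generalizing a b
  · rw [abs_sub_comm, abs_sub_comm a, add_comm]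
    exact this b a (le_of_not_ge h)
  rw [abs_of_nonneg (sub_nonneg.2 (exp_le_exp.2 h)), abs_of_nonneg (sub_nonneg.2 h)]
  have h1 : exp b = exp a * exp (b - a) := by rw [← exp_add]; ring_nf
  have h2 := add_one_le_exp (b - a)
  have h3 := mul_le_mul_of_nonneg_left h2 (exp_pos a).le
  nlinarith [mul_nonneg (sub_nonneg.2 h) (exp_pos b).le]

lemma abs_exp_neg_sub_exp_neg_le (a b : ℝ) :
    |exp (-a) - exp (-b)| ≤ |a - b| * (exp (-a) + exp (-b)) := by
  have h := abs_exp_sub_exp_le (-a) (-b)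
  rwa [neg_sub_neg, abs_sub_comm b a] at h

lemma abs_exp_neg_abs_sub_le (a b : ℝ) :
    |exp (-|a|) - exp (-|b|)| ≤ |a - b| * (exp (-|a|) + exp (-|b|)) :=
  (abs_exp_neg_sub_exp_neg_le _ _).trans <| by
    refine mul_le_mul_of_nonneg_right (abs_abs_sub_abs_le a b) ?_
    positivity

lemma exp_neg_abs_le_exp_mul (a b : ℝ) : exp (-|a|) ≤ exp |a - b| * exp (-|b|) := by
  rw [← exp_add, exp_le_exp]
  have := abs_sub_abs_le_abs_sub b a
  rw [abs_sub_comm] at this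
  linarith

lemma cosh_le_exp_mul_cosh (a b : ℝ) : cosh a ≤ exp |a - b| * cosh b := by
  have h1 : exp a ≤ exp |a - b| * exp b := by
    rw [← exp_add, exp_le_exp]
    linarith [le_abs_self (a - b)]
  have h2 : exp (-a) ≤ exp |a - b| * exp (-b) := by
    rw [← exp_add, exp_le_exp]
    linarith [neg_abs_le (a - b)]
  rw [cosh_eq, cosh_eq]
  linarith

lemma abs_sinh_sub_sinh_le (a b : ℝ) : |sinh a - sinh b| ≤ |a - b| * (cosh a + cosh b) := by
  have h1 := abs_le.1 (abs_exp_sub_exp_le a b)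
  have h2 := abs_le.1 (abs_exp_neg_sub_exp_neg_le a b)
  rw [abs_le, sinh_eq, sinh_eq, cosh_eq, cosh_eq]
  constructor <;> linarith

lemma abs_boostFactor_sub_le {y : ℝ} (hy : y ∈ Ioo (-1 : ℝ) 1) (a b : ℝ) :
    |boostFactor a y - boostFactor b y| ≤ |a - b| * (boostFactor a y + boostFactor b y) := by
  have h1 := abs_le.1 (abs_exp_sub_exp_le a b)
  have h2 := abs_le.1 (abs_exp_neg_sub_exp_neg_le a b)
  have hy1 : 0 ≤ (1 + y) / 2 := by linarith [hy.1]
  have hy2 : 0 ≤ (1 - y) / 2 := by linarith [hy.2]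
  have hE (ξ : ℝ) : boostFactor ξ y = (1 + y) / 2 * exp ξ + (1 - y) / 2 * exp (-ξ) := by
    rw [boostFactor, sinh_eq, cosh_eq]
    ring
  rw [abs_le, hE, hE]
  constructor
  · nlinarith [mul_le_mul_of_nonneg_left h1.1 hy1, mul_le_mul_of_nonneg_left h2.1 hy2]
  · nlinarith [mul_le_mul_of_nonneg_left h1.2 hy1, mul_le_mul_of_nonneg_left h2.2 hy2]

lemma abs_mul_exp_neg_abs_sub_le {B μ₁ μ₂ : ℝ} (hμ₂ : |μ₂| ≤ B) (ξ₁ ξ₂ : ℝ) :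
    |μ₁ * exp (-|ξ₁|) - μ₂ * exp (-|ξ₂|)| ≤
      (1 + B) * (|μ₁ - μ₂| + |ξ₁ - ξ₂|) * (exp (-|ξ₁|) + exp (-|ξ₂|)) := by
  have h := abs_exp_neg_abs_sub_le ξ₁ ξ₂
  have he₁ := exp_pos (-|ξ₁|)
  have he₂ := exp_pos (-|ξ₂|)
  have hB : 0 ≤ B := (abs_nonneg _).trans hμ₂
  calc |μ₁ * exp (-|ξ₁|) - μ₂ * exp (-|ξ₂|)|
      = |(μ₁ - μ₂) * exp (-|ξ₁|) + μ₂ * (exp (-|ξ₁|) - exp (-|ξ₂|))| := by ring_nf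
    _ ≤ |μ₁ - μ₂| * exp (-|ξ₁|) + |μ₂| * |exp (-|ξ₁|) - exp (-|ξ₂|)| := by
        refine (abs_add_le _ _).trans ?_
        rw [abs_mul, abs_mul, abs_of_pos he₁]
    _ ≤ |μ₁ - μ₂| * (exp (-|ξ₁|) + exp (-|ξ₂|)) +
          B * (|ξ₁ - ξ₂| * (exp (-|ξ₁|) + exp (-|ξ₂|))) := by
        gcongr
        linarith
    _ ≤ _ := by
        have : |μ₁ - μ₂| + B * |ξ₁ - ξ₂| ≤ (1 + B) * (|μ₁ - μ₂| + |ξ₁ - ξ₂|) := by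
          nlinarith [abs_nonneg (μ₁ - μ₂), abs_nonneg (ξ₁ - ξ₂),
            mul_nonneg hB (abs_nonneg (μ₁ - μ₂))]
        nlinarith [mul_le_mul_of_nonneg_right this (add_pos he₁ he₂).le]

lemma abs_solitonDenom_sub_le {B y μ₁ μ₂ : ℝ} (hB : 2 ≤ B) (hy : y ∈ Ioo (-1 : ℝ) 1)
    (hμ₁ : -1 + 1 / B ≤ μ₁) (hμ₂ : -1 + 1 / B ≤ μ₂) (hμ₂' : |μ₂| ≤ B) (ξ₁ ξ₂ : ℝ) :
    |solitonDenom ξ₁ μ₁ y - solitonDenom ξ₂ μ₂ y| ≤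
      B * (2 + B) * (|μ₁ - μ₂| + |ξ₁ - ξ₂|) *
        (solitonDenom ξ₁ μ₁ y + solitonDenom ξ₂ μ₂ y) := by
  set δ := |μ₁ - μ₂| + |ξ₁ - ξ₂| with hδ
  have hδ1 : |ξ₁ - ξ₂| ≤ δ := by linarith [abs_nonneg (μ₁ - μ₂)]
  have hδ0 : 0 ≤ δ := by positivity
  have h1 := abs_boostFactor_sub_le hy ξ₁ ξ₂
  have h2 := abs_mul_exp_neg_abs_sub_le (μ₁ := μ₁) hμ₂' ξ₁ ξ₂
  have hE₁ := boostFactor_pos hy ξ₁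
  have hE₂ := boostFactor_pos hy ξ₂
  calc |solitonDenom ξ₁ μ₁ y - solitonDenom ξ₂ μ₂ y|
      = |(boostFactor ξ₁ y - boostFactor ξ₂ y) +
          (μ₁ * exp (-|ξ₁|) - μ₂ * exp (-|ξ₂|))| := by
        simp only [solitonDenom]
        ring_nf
    _ ≤ δ * (boostFactor ξ₁ y + boostFactor ξ₂ y) +
          (1 + B) * δ * (boostFactor ξ₁ y + boostFactor ξ₂ y) := by
        refine (abs_add_le _ _).trans (add_le_add (h1.trans (by gcongr)) (h2.trans ?_))
        gcongr <;> exact exp_neg_abs_le_boostFactor hy _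
    _ = (2 + B) * δ * (boostFactor ξ₁ y + boostFactor ξ₂ y) := by ring
    _ ≤ (2 + B) * δ * (B * solitonDenom ξ₁ μ₁ y + B * solitonDenom ξ₂ μ₂ y) := by
        gcongr
        · exact boostFactor_le_mul_solitonDenom hB hy hμ₁ ξ₁
        · exact boostFactor_le_mul_solitonDenom hB hy hμ₂ ξ₂
    _ = _ := by ring

lemma one_sub_rpow_le {r s : ℝ} (hr : 0 < r) (hr1 : r ≤ 1) (hs : 0 ≤ s) :
    1 - r ^ s ≤ (1 + s) * (1 - r) := by
  rcases le_total 1 s with h | h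
  · have := one_add_mul_self_le_rpow_one_add (s := r - 1) (by linarith) h
    rw [add_sub_cancel] at this
    nlinarith
  · have := rpow_le_rpow_of_exponent_ge hr hr1 h
    rw [rpow_one] at this
    nlinarith

lemma abs_rpow_neg_sub_le {a b k s : ℝ} (ha : 0 < a) (hb : 0 < b) (hs : 0 ≤ s)
    (h : |a - b| ≤ k * (a + b)) :
    |a ^ (-s) - b ^ (-s)| ≤ 2 * (1 + s) * k * (a ^ (-s) + b ^ (-s)) := by
  wlog hab : a ≤ b generalizing a b
  · rw [abs_sub_comm, add_comm (a ^ (-s))]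
    exact this hb ha (by rwa [abs_sub_comm, add_comm]) (le_of_not_ge hab)
  have hk : 0 ≤ k := by
    have := (abs_nonneg _).trans h
    by_contra! hk
    nlinarith
  have hanti := rpow_le_rpow_of_nonpos ha hab (neg_nonpos.2 hs)
  rw [abs_of_nonneg (sub_nonneg.2 hanti)]
  rw [abs_sub_comm, abs_of_nonneg (sub_nonneg.2 hab)] at h
  have hr1 : 1 - a / b ≤ 2 * k := by
    rw [sub_le_iff_le_add, ← sub_le_iff_le_add', le_div_iff₀ hb]
    nlinarith
  have h1 := one_sub_rpow_le (div_pos ha hb) ((div_le_one hb).2 hab) hs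
  have h2 : b ^ (-s) = a ^ (-s) * (a / b) ^ s := by
    rw [div_rpow ha.le hb.le, rpow_neg ha.le, rpow_neg hb.le]
    have := (rpow_pos_of_pos ha s).ne'
    field_simp
  have hA := rpow_pos_of_pos ha (-s)
  have hBp := rpow_pos_of_pos hb (-s)
  calc a ^ (-s) - b ^ (-s) = a ^ (-s) * (1 - (a / b) ^ s) := by rw [h2]; ring
    _ ≤ a ^ (-s) * ((1 + s) * (2 * k)) := by
        refine mul_le_mul_of_nonneg_left (h1.trans ?_) hA.le
        gcongr
    _ ≤ _ := by
        have : 0 ≤ 2 * (1 + s) * k * b ^ (-s) := by positivity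
        linarith

lemma abs_mul_sub_mul_le {f₁ f₂ F₁ F₂ g₁ g₂ k l δ : ℝ} (hδ : 0 ≤ δ) (hk : 0 ≤ k) (hl : 0 ≤ l)
    (hF₁ : 0 ≤ F₁) (hF₂ : 0 ≤ F₂) (hg₁ : 0 ≤ g₁) (hg₂ : 0 ≤ g₂)
    (hf₁ : |f₁| ≤ k * F₁) (hf₂ : |f₂| ≤ k * F₂) (hf : |f₁ - f₂| ≤ k * δ * (F₁ + F₂))
    (hF : F₁ ≤ exp δ * F₂) (hg : |g₁ - g₂| ≤ l * δ * (g₁ + g₂)) :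
    |f₁ * g₁ - f₂ * g₂| ≤ k * (3 * l + 4) * δ * (F₁ * g₁ + F₂ * g₂) := by
  have hS : 0 ≤ F₁ * g₁ + F₂ * g₂ := by positivity
  rcases le_total 1 δ with h | h
  · calc |f₁ * g₁ - f₂ * g₂| ≤ |f₁| * g₁ + |f₂| * g₂ := by
          refine (abs_sub _ _).trans ?_
          rw [abs_mul, abs_mul, abs_of_nonneg hg₁, abs_of_nonneg hg₂]
      _ ≤ k * F₁ * g₁ + k * F₂ * g₂ := by gcongr
      _ = k * 1 * 1 * (F₁ * g₁ + F₂ * g₂) := by ring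
      _ ≤ _ := by
          gcongr
          linarith
  · have hF' : F₁ ≤ 3 * F₂ := by
      refine hF.trans ?_
      gcongr
      exact (exp_le_exp.2 h).trans exp_one_lt_three.le
    calc |f₁ * g₁ - f₂ * g₂| = |f₁ * (g₁ - g₂) + (f₁ - f₂) * g₂| := by ring_nf
      _ ≤ |f₁| * |g₁ - g₂| + |f₁ - f₂| * g₂ := by
          refine (abs_add_le _ _).trans ?_
          rw [abs_mul, abs_mul, abs_of_nonneg hg₂]
      _ ≤ k * F₁ * (l * δ * (g₁ + g₂)) + k * δ * (F₁ + F₂) * g₂ := by gcongr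
      _ = k * l * δ * (F₁ * g₁) + k * l * δ * (F₁ * g₂) + k * δ * (F₁ * g₂)
            + k * δ * (F₂ * g₂) := by ring
      _ ≤ k * l * δ * (F₁ * g₁) + k * l * δ * (3 * F₂ * g₂) + k * δ * (3 * F₂ * g₂)
            + k * δ * (F₂ * g₂) := by gcongr
      _ = k * (3 * l + 4) * δ * (F₁ * g₁ + F₂ * g₂)
            - k * δ * (2 * l + 4) * (F₁ * g₁) := by ring
      _ ≤ _ := by
          have : 0 ≤ k * δ * (2 * l + 4) * (F₁ * g₁) := by positivity
          linarith

/-! ### The weight and its Lorentz invariance -/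

lemma integrableOn_one_sub_sq_rpow {α : ℝ} (hα : 0 < α) :
    IntegrableOn (fun y : ℝ => (1 - y ^ 2) ^ (α - 1)) (Ioo (-1) 1) := by
  have h0 : IntervalIntegrable (fun x : ℝ => x ^ (α - 1)) volume 0 2 :=
    intervalIntegral.intervalIntegrable_rpow' (by linarith)
  have h1 : IntervalIntegrable (fun y : ℝ => (1 + y) ^ (α - 1)) volume (-1) 1 := by
    have := h0.comp_add_left 1
    norm_num at this
    exact this
  have h2 : IntervalIntegrable (fun y : ℝ => (1 - y) ^ (α - 1)) volume (-1) 1 := by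
    have := (h0.comp_sub_left 1).symm
    norm_num at this
    exact this
  have h3 := ((h1.add h2).const_mul (2 ^ |α - 1|))
  rw [intervalIntegrable_iff_integrableOn_Ioo_of_le (by norm_num)] at h3
  have key {a b : ℝ} (ha : 0 < a) (hb : 1 ≤ b) (hb2 : b ≤ 2) :
      (a * b) ^ (α - 1) ≤ 2 ^ |α - 1| * a ^ (α - 1) := by
    rw [mul_rpow ha.le (by linarith), mul_comm]
    gcongr
    exact (rpow_le_rpow_of_exponent_le hb (le_abs_self _)).trans
      (rpow_le_rpow (by linarith) hb2 (abs_nonneg _))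
  refine Integrable.mono' h3 (Measurable.aestronglyMeasurable (by fun_prop)) ?_
  filter_upwards [ae_restrict_mem measurableSet_Ioo] with y hy
  have hp : 0 < 1 + y := by linarith [hy.1]
  have hm : 0 < 1 - y := by linarith [hy.2]
  have hP := rpow_pos_of_pos hp (α - 1)
  have hM := rpow_pos_of_pos hm (α - 1)
  have h2p : (0 : ℝ) < 2 ^ |α - 1| := by positivity
  have hsq : 1 - y ^ 2 = (1 + y) * (1 - y) := by ring
  rw [norm_of_nonneg (by rw [hsq]; positivity), hsq, mul_add]
  rcases le_total 0 y with h | h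
  · rw [mul_comm (1 + y)]
    have := key hm (b := 1 + y) (by linarith) (by linarith [hy.2])
    nlinarith
  · have := key hp (b := 1 - y) (by linarith) (by linarith [hy.1])
    nlinarith

/-- The Lorentz transform of the weight `(1 - y²)^(α - 1)`. -/
def boostWeight (α ξ y : ℝ) : ℝ := (1 - y ^ 2) ^ (α - 1) * boostFactor ξ y ^ (-(2 * α))

lemma integrableOn_boostWeight {α : ℝ} (hα : 0 < α) (ξ : ℝ) :
    IntegrableOn (boostWeight α ξ) (Ioo (-1) 1) ∧
      ∫ y in Ioo (-1 : ℝ) 1, boostWeight α ξ y ≤ ∫ y in Ioo (-1 : ℝ) 1, (1 - y ^ 2) ^ (α - 1) := by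
  set f : ℝ → ℝ := fun y => (sinh ξ + cosh ξ * y) / boostFactor ξ y with hf
  set f' : ℝ → ℝ := fun y => 1 / boostFactor ξ y ^ 2 with hf'
  have hcs := cosh_sq_sub_sinh_sq ξ
  have hderiv : ∀ y ∈ Ioo (-1 : ℝ) 1, HasDerivWithinAt f (f' y) (Ioo (-1) 1) y := by
    intro y hy
    have hE := (boostFactor_pos hy ξ).ne'
    have h1 : HasDerivAt (fun y => sinh ξ + cosh ξ * y) (cosh ξ) y := by
      simpa using ((hasDerivAt_id y).const_mul (cosh ξ)).const_add (sinh ξ)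
    refine (h1.div (hasDerivAt_boostFactor ξ y) hE).hasDerivWithinAt.congr_deriv ?_
    simp only [hf']
    congr 1
    rw [boostFactor]
    linear_combination hcs
  have hinj : InjOn f (Ioo (-1) 1) := by
    intro x hx y hy hxy
    have hEx := (boostFactor_pos hx ξ).ne'
    have hEy := (boostFactor_pos hy ξ).ne'
    simp only [hf] at hxy
    rw [div_eq_div_iff hEx hEy] at hxy
    simp only [boostFactor] at hxy
    linear_combination hxy - (x - y) * hcs
  have hone {y : ℝ} (hy : y ∈ Ioo (-1 : ℝ) 1) :
      1 - f y ^ 2 = (1 - y ^ 2) / boostFactor ξ y ^ 2 := by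
    have hE := (boostFactor_pos hy ξ).ne'
    simp only [hf]
    rw [div_pow, eq_div_iff (pow_ne_zero 2 hE), sub_mul, div_mul_cancel₀ _ (pow_ne_zero 2 hE),
      boostFactor]
    linear_combination (1 - y ^ 2) * hcs
  have hpos {y : ℝ} (hy : y ∈ Ioo (-1 : ℝ) 1) : 0 < 1 - y ^ 2 := by
    nlinarith [hy.1, hy.2]
  have himage : f '' Ioo (-1) 1 ⊆ Ioo (-1) 1 := by
    rintro _ ⟨y, hy, rfl⟩
    have : 0 < 1 - f y ^ 2 := by
      rw [hone hy]
      exact div_pos (hpos hy) (pow_pos (boostFactor_pos hy ξ) 2)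
    exact abs_lt.1 ((sq_lt_one_iff_abs_lt_one _).1 (by linarith))
  have hw : ∀ y ∈ Ioo (-1 : ℝ) 1, |f' y| • (1 - f y ^ 2) ^ (α - 1) = boostWeight α ξ y := by
    intro y hy
    have hE := boostFactor_pos hy ξ
    rw [hone hy, div_rpow (hpos hy).le (sq_nonneg _), boostWeight, smul_eq_mul,
      abs_of_pos (by positivity), ← rpow_natCast (boostFactor ξ y), ← rpow_mul hE.le,
      rpow_neg hE.le]
    have h2 : boostFactor ξ y ^ (2 * α) = boostFactor ξ y ^ ((2 : ℕ) : ℝ) *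
        boostFactor ξ y ^ (((2 : ℕ) : ℝ) * (α - 1)) := by
      rw [← rpow_add hE]
      congr 1
      push_cast
      ring
    rw [h2, rpow_natCast]
    simp only [hf']
    field_simp
  have hint := integrableOn_one_sub_sq_rpow hα
  constructor
  · refine (integrableOn_congr_fun hw measurableSet_Ioo).1 ?_
    exact (integrableOn_image_iff_integrableOn_abs_deriv_smul measurableSet_Ioo hderiv hinj
      (fun y => (1 - y ^ 2) ^ (α - 1))).1 (hint.mono_set himage)
  · rw [← setIntegral_congr_fun measurableSet_Ioo hw,
      ← integral_image_eq_integral_abs_deriv_smul measurableSet_Ioo hderiv hinj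
      (fun y => (1 - y ^ 2) ^ (α - 1))]
    refine setIntegral_mono_set hint ?_ himage.eventuallyLE
    filter_upwards [ae_restrict_mem measurableSet_Ioo] with y hy
    exact rpow_nonneg (hpos hy).le _

/-! ### The generalized soliton in hyperbolic variables -/

lemma arctanhR_eq_artanh {d : ℝ} (hd : |d| < 1) : arctanhR d = artanh d :=
  (artanh_eq_half_log ⟨(abs_lt.1 hd).1.le, (abs_lt.1 hd).2.le⟩).symm

lemma sinh_arctanhR {d : ℝ} (hd : |d| < 1) : sinh (arctanhR d) = d * cosh (arctanhR d) := by
  rw [arctanhR_eq_artanh hd]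
  conv_rhs => rw [← tanh_artanh (abs_lt.1 hd), artanh_tanh, tanh_eq_sinh_div_cosh,
    div_mul_cancel₀ _ (cosh_pos _).ne']

lemma exp_neg_abs_arctanhR {d : ℝ} (hd : |d| < 1) :
    exp (-|arctanhR d|) = (1 - |d|) * cosh (arctanhR d) := by
  rw [← cosh_sub_abs_sinh, sinh_arctanhR hd, abs_mul, abs_of_pos (cosh_pos _)]
  ring

lemma one_sub_sq_eq_inv_cosh_sq {d : ℝ} (hd : |d| < 1) :
    1 - d ^ 2 = (cosh (arctanhR d) ^ 2)⁻¹ := by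
  have h := cosh_sq_sub_sinh_sq (arctanhR d)
  rw [sinh_arctanhR hd] at h
  rw [← one_div, eq_div_iff (pow_pos (cosh_pos _) 2).ne']
  linear_combination h

lemma one_sub_sq_rpow {p d : ℝ} (hd : |d| < 1) :
    (1 - d ^ 2) ^ ((1 : ℝ) / (p - 1)) = (cosh (arctanhR d) ^ (2 / (p - 1)))⁻¹ := by
  have hc := cosh_pos (arctanhR d)
  rw [one_sub_sq_eq_inv_cosh_sq hd, inv_rpow (sq_nonneg _), ← rpow_natCast, ← rpow_mul hc.le]
  congr 2
  push_cast
  ring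

lemma one_add_mul_add_eq {d : ℝ} (hd : |d| < 1) (ν y : ℝ) :
    1 + d * y + ν =
      solitonDenom (arctanhR d) (ν / (1 - |d|)) y / cosh (arctanhR d) := by
  have hd' : 1 - |d| ≠ 0 := by linarith
  have hc := (cosh_pos (arctanhR d)).ne'
  rw [eq_div_iff hc, solitonDenom, boostFactor, exp_neg_abs_arctanhR hd, sinh_arctanhR hd]
  field_simp

lemma kappaStar1_eq {B p d ν y : ℝ} (hB : 2 ≤ B) (hd : |d| < 1)
    (hμ : -1 + 1 / B ≤ ν / (1 - |d|)) (hy : y ∈ Ioo (-1 : ℝ) 1) :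
    kappaStar1 p d ν y =
      kappa0 p * solitonDenom (arctanhR d) (ν / (1 - |d|)) y ^ (-(2 / (p - 1))) := by
  have hD := solitonDenom_pos hB hy hμ (arctanhR d)
  have hc := cosh_pos (arctanhR d)
  have hcα := (rpow_pos_of_pos hc (2 / (p - 1))).ne'
  rw [kappaStar1, one_sub_sq_rpow hd, one_add_mul_add_eq hd, div_rpow hD.le hc.le,
    rpow_neg hD.le]
  have hDα := (rpow_pos_of_pos hD (2 / (p - 1))).ne'
  field_simp

lemma kappaStar2_eq {B p d ν y : ℝ} (hp : 1 < p) (hB : 2 ≤ B) (hd : |d| < 1)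
    (hμ : -1 + 1 / B ≤ ν / (1 - |d|)) (hy : y ∈ Ioo (-1 : ℝ) 1) :
    kappaStar2 p d ν y =
      -(2 / (p - 1) * kappa0 p) * (ν / (1 - |d|) * exp (-|arctanhR d|) *
        solitonDenom (arctanhR d) (ν / (1 - |d|)) y ^ (-(2 / (p - 1) + 1))) := by
  have hD := solitonDenom_pos hB hy hμ (arctanhR d)
  have hc := cosh_pos (arctanhR d)
  have hp' : p - 1 ≠ 0 := by linarith
  have hd' : 1 - |d| ≠ 0 := by linarith
  have hexp : (p + 1) / (p - 1) = 2 / (p - 1) + 1 := by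
    field_simp
    ring
  have hcα := (rpow_pos_of_pos hc (2 / (p - 1))).ne'
  have hDα := (rpow_pos_of_pos hD (2 / (p - 1) + 1)).ne'
  rw [kappaStar2, one_sub_sq_rpow hd, one_add_mul_add_eq hd, hexp, div_rpow hD.le hc.le,
    rpow_neg hD.le, exp_neg_abs_arctanhR hd, rpow_add_one hc.ne']
  field_simp

lemma hasDerivAt_kappaStar1 {B p d ν y : ℝ} (hB : 2 ≤ B) (hd : |d| < 1)
    (hμ : -1 + 1 / B ≤ ν / (1 - |d|)) (hy : y ∈ Ioo (-1 : ℝ) 1) :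
    HasDerivAt (fun y => kappaStar1 p d ν y)
      (-(2 / (p - 1) * kappa0 p) * (sinh (arctanhR d) *
        solitonDenom (arctanhR d) (ν / (1 - |d|)) y ^ (-(2 / (p - 1) + 1)))) y := by
  have hD := solitonDenom_pos hB hy hμ (arctanhR d)
  have h1 := hasDerivAt_solitonDenom (arctanhR d) (ν / (1 - |d|)) y
  have h2 := (h1.rpow_const (p := -(2 / (p - 1))) (Or.inl hD.ne')).const_mul (kappa0 p)
  refine (h2.congr_of_eventuallyEq ?_).congr_deriv ?_
  · filter_upwards [isOpen_Ioo.mem_nhds hy] with z hz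
    exact kappaStar1_eq hB hd hμ hz
  · rw [neg_add]
    ring_nf

/-- The Lipschitz constant of the soliton profiles in hyperbolic variables. -/
def profileConst (α B : ℝ) : ℝ :=
  (1 + B) * (3 * (2 * (1 + (α + 1)) * (B * (2 + B))) + 4) * B ^ (α + 1)

section Profiles

variable {α B y μ₁ μ₂ : ℝ}

lemma profileConst_nonneg (hα : 0 < α) (hB : 2 ≤ B) : 0 ≤ profileConst α B := by
  have : 0 ≤ B := by linarith
  unfold profileConst
  positivity

lemma abs_solitonDenom_rpow_sub_le {s : ℝ} (hs : 0 ≤ s) (hB : 2 ≤ B) (hy : y ∈ Ioo (-1 : ℝ) 1)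
    (hμ₁ : -1 + 1 / B ≤ μ₁) (hμ₂ : -1 + 1 / B ≤ μ₂) (hμ₂' : |μ₂| ≤ B) (ξ₁ ξ₂ : ℝ) :
    |solitonDenom ξ₁ μ₁ y ^ (-s) - solitonDenom ξ₂ μ₂ y ^ (-s)| ≤
      2 * (1 + s) * (B * (2 + B)) * (|μ₁ - μ₂| + |ξ₁ - ξ₂|) *
        (solitonDenom ξ₁ μ₁ y ^ (-s) + solitonDenom ξ₂ μ₂ y ^ (-s)) := by
  have h := abs_rpow_neg_sub_le (solitonDenom_pos hB hy hμ₁ ξ₁) (solitonDenom_pos hB hy hμ₂ ξ₂) hs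
    (abs_solitonDenom_sub_le hB hy hμ₁ hμ₂ hμ₂' ξ₁ ξ₂)
  simpa only [mul_assoc] using h

lemma abs_value_profile_sub_le (hα : 0 < α) (hB : 2 ≤ B) (hy : y ∈ Ioo (-1 : ℝ) 1)
    (hμ₁ : -1 + 1 / B ≤ μ₁) (hμ₂ : -1 + 1 / B ≤ μ₂) (hμ₂' : |μ₂| ≤ B) (ξ₁ ξ₂ : ℝ) :
    |solitonDenom ξ₁ μ₁ y ^ (-α) - solitonDenom ξ₂ μ₂ y ^ (-α)| ≤
      profileConst α B * (|μ₁ - μ₂| + |ξ₁ - ξ₂|) *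
        (boostFactor ξ₁ y ^ (-α) + boostFactor ξ₂ y ^ (-α)) := by
  have hB0 : 0 ≤ B := by linarith
  have hE₁ := (boostFactor_pos hy ξ₁).le
  have hE₂ := (boostFactor_pos hy ξ₂).le
  set δ := |μ₁ - μ₂| + |ξ₁ - ξ₂| with hδ
  calc |solitonDenom ξ₁ μ₁ y ^ (-α) - solitonDenom ξ₂ μ₂ y ^ (-α)|
      ≤ 2 * (1 + α) * (B * (2 + B)) * δ *
        (solitonDenom ξ₁ μ₁ y ^ (-α) + solitonDenom ξ₂ μ₂ y ^ (-α)) :=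
        abs_solitonDenom_rpow_sub_le hα.le hB hy hμ₁ hμ₂ hμ₂' ξ₁ ξ₂
    _ ≤ 2 * (1 + α) * (B * (2 + B)) * δ *
        (B ^ α * boostFactor ξ₁ y ^ (-α) + B ^ α * boostFactor ξ₂ y ^ (-α)) := by
        gcongr <;> exact solitonDenom_rpow_neg_le hB hy ‹_› hα.le _
    _ = (1 * (2 * (1 + α) * (B * (2 + B))) * B ^ α) * δ *
        (boostFactor ξ₁ y ^ (-α) + boostFactor ξ₂ y ^ (-α)) := by ring
    _ ≤ _ := by
        have h1 : 2 * (1 + α) * (B * (2 + B)) ≤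
            3 * (2 * (1 + (α + 1)) * (B * (2 + B))) + 4 := by
          have : 0 ≤ B * (2 + B) := by positivity
          nlinarith [mul_nonneg hα.le this]
        have h2 : B ^ α ≤ B ^ (α + 1) := rpow_le_rpow_of_exponent_le (by linarith) (by linarith)
        unfold profileConst
        gcongr
        linarith

lemma abs_deriv_profile_sub_le (hα : 0 < α) (hB : 2 ≤ B) (hy : y ∈ Ioo (-1 : ℝ) 1)
    (hμ₁ : -1 + 1 / B ≤ μ₁) (hμ₂ : -1 + 1 / B ≤ μ₂) (hμ₂' : |μ₂| ≤ B) (ξ₁ ξ₂ : ℝ) :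
    |sinh ξ₁ * solitonDenom ξ₁ μ₁ y ^ (-(α + 1)) -
        sinh ξ₂ * solitonDenom ξ₂ μ₂ y ^ (-(α + 1))| ≤
      profileConst α B * (|μ₁ - μ₂| + |ξ₁ - ξ₂|) *
        (cosh ξ₁ * boostFactor ξ₁ y ^ (-(α + 1)) + cosh ξ₂ * boostFactor ξ₂ y ^ (-(α + 1))) := by
  have hB0 : 0 ≤ B := by linarith
  have hα1 : 0 ≤ α + 1 := by linarith
  have hE₁ := (boostFactor_pos hy ξ₁).le
  have hE₂ := (boostFactor_pos hy ξ₂).le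
  have hD₁ := (solitonDenom_pos hB hy hμ₁ ξ₁).le
  have hD₂ := (solitonDenom_pos hB hy hμ₂ ξ₂).le
  have hc₁ := (cosh_pos ξ₁).le
  have hc₂ := (cosh_pos ξ₂).le
  have hs (ξ : ℝ) : |sinh ξ| ≤ 1 * cosh ξ := by
    linarith [cosh_sub_abs_sinh ξ, exp_pos (-|ξ|)]
  set δ := |μ₁ - μ₂| + |ξ₁ - ξ₂| with hδ
  have hle : |ξ₁ - ξ₂| ≤ δ := by linarith [abs_nonneg (μ₁ - μ₂)]
  have h := abs_mul_sub_mul_le (δ := δ) (k := 1) (by positivity) zero_le_one (by positivity)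
    hc₁ hc₂ (rpow_nonneg hD₁ _) (rpow_nonneg hD₂ _) (hs ξ₁) (hs ξ₂)
    ((abs_sinh_sub_sinh_le ξ₁ ξ₂).trans (by rw [one_mul]; gcongr))
    ((cosh_le_exp_mul_cosh ξ₁ ξ₂).trans (by gcongr))
    (abs_solitonDenom_rpow_sub_le hα1 hB hy hμ₁ hμ₂ hμ₂' ξ₁ ξ₂)
  refine h.trans ?_
  calc _ ≤ (1 + B) * (3 * (2 * (1 + (α + 1)) * (B * (2 + B))) + 4) * δ *
        (cosh ξ₁ * (B ^ (α + 1) * boostFactor ξ₁ y ^ (-(α + 1))) +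
          cosh ξ₂ * (B ^ (α + 1) * boostFactor ξ₂ y ^ (-(α + 1)))) := by
        gcongr
        · linarith
        · exact solitonDenom_rpow_neg_le hB hy hμ₁ hα1 ξ₁
        · exact solitonDenom_rpow_neg_le hB hy hμ₂ hα1 ξ₂
    _ = _ := by
        unfold profileConst
        ring

lemma exp_neg_abs_mul_solitonDenom_rpow_le {μ : ℝ} (hα : 0 < α) (hB : 2 ≤ B)
    (hy : y ∈ Ioo (-1 : ℝ) 1) (hμ : -1 + 1 / B ≤ μ) (ξ : ℝ) :
    exp (-|ξ|) * solitonDenom ξ μ y ^ (-(α + 1)) ≤ B ^ (α + 1) * boostFactor ξ y ^ (-α) := by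
  have hE := boostFactor_pos hy ξ
  have hB0 : 0 ≤ B := by linarith
  calc exp (-|ξ|) * solitonDenom ξ μ y ^ (-(α + 1))
      ≤ boostFactor ξ y * (B ^ (α + 1) * boostFactor ξ y ^ (-(α + 1))) := by
        have := (solitonDenom_pos hB hy hμ ξ).le
        gcongr
        · exact exp_neg_abs_le_boostFactor hy ξ
        · exact solitonDenom_rpow_neg_le hB hy hμ (by linarith) ξ
    _ = _ := by
        rw [neg_add, rpow_add hE, rpow_neg_one]
        field_simp

lemma abs_velocity_profile_sub_le (hα : 0 < α) (hB : 2 ≤ B) (hy : y ∈ Ioo (-1 : ℝ) 1)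
    (hμ₁ : -1 + 1 / B ≤ μ₁) (hμ₂ : -1 + 1 / B ≤ μ₂) (hμ₁' : |μ₁| ≤ B) (hμ₂' : |μ₂| ≤ B)
    (ξ₁ ξ₂ : ℝ) :
    |μ₁ * exp (-|ξ₁|) * solitonDenom ξ₁ μ₁ y ^ (-(α + 1)) -
        μ₂ * exp (-|ξ₂|) * solitonDenom ξ₂ μ₂ y ^ (-(α + 1))| ≤
      profileConst α B * (|μ₁ - μ₂| + |ξ₁ - ξ₂|) *
        (boostFactor ξ₁ y ^ (-α) + boostFactor ξ₂ y ^ (-α)) := by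
  have hB0 : 0 ≤ B := by linarith
  have hα1 : 0 ≤ α + 1 := by linarith
  have hD₁ := (solitonDenom_pos hB hy hμ₁ ξ₁).le
  have hD₂ := (solitonDenom_pos hB hy hμ₂ ξ₂).le
  have hs {μ : ℝ} (hμ : |μ| ≤ B) (ξ : ℝ) : |μ * exp (-|ξ|)| ≤ (1 + B) * exp (-|ξ|) := by
    rw [abs_mul, abs_exp]
    gcongr
    linarith
  set δ := |μ₁ - μ₂| + |ξ₁ - ξ₂| with hδ
  have hle : |ξ₁ - ξ₂| ≤ δ := by linarith [abs_nonneg (μ₁ - μ₂)]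
  have h := abs_mul_sub_mul_le (δ := δ) (k := 1 + B) (by positivity) (by positivity)
    (by positivity) (exp_pos (-|ξ₁|)).le (exp_pos (-|ξ₂|)).le (rpow_nonneg hD₁ _)
    (rpow_nonneg hD₂ _) (hs hμ₁' ξ₁) (hs hμ₂' ξ₂) (abs_mul_exp_neg_abs_sub_le hμ₂' ξ₁ ξ₂)
    ((exp_neg_abs_le_exp_mul ξ₁ ξ₂).trans (by gcongr))
    (abs_solitonDenom_rpow_sub_le hα1 hB hy hμ₁ hμ₂ hμ₂' ξ₁ ξ₂)
  refine h.trans ?_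
  calc _ ≤ (1 + B) * (3 * (2 * (1 + (α + 1)) * (B * (2 + B))) + 4) * δ *
        (B ^ (α + 1) * boostFactor ξ₁ y ^ (-α) + B ^ (α + 1) * boostFactor ξ₂ y ^ (-α)) := by
        refine mul_le_mul_of_nonneg_left (add_le_add ?_ ?_) (by positivity)
        · exact exp_neg_abs_mul_solitonDenom_rpow_le hα hB hy hμ₁ ξ₁
        · exact exp_neg_abs_mul_solitonDenom_rpow_le hα hB hy hμ₂ ξ₂
    _ = _ := by
        unfold profileConst
        ring

end Profiles

lemma sq_boostFactor_rpow_mul_le {α y : ℝ} (hy : y ∈ Ioo (-1 : ℝ) 1) (ξ : ℝ) :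
    (boostFactor ξ y ^ (-α)) ^ 2 * (1 - y ^ 2) ^ α ≤ boostWeight α ξ y := by
  have hE := boostFactor_pos hy ξ
  have ht : 0 < 1 - y ^ 2 := by nlinarith [hy.1, hy.2]
  have h1 : (boostFactor ξ y ^ (-α)) ^ 2 = boostFactor ξ y ^ (-(2 * α)) := by
    rw [← rpow_natCast, ← rpow_mul hE.le]
    congr 1
    push_cast
    ring
  rw [h1, boostWeight, mul_comm]
  refine mul_le_mul_of_nonneg_right ?_ (rpow_nonneg hE.le _)
  exact rpow_le_rpow_of_exponent_ge ht (by nlinarith [sq_nonneg y]) (by linarith)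

lemma sq_cosh_mul_boostFactor_rpow_mul_le {α y : ℝ} (hy : y ∈ Ioo (-1 : ℝ) 1) (ξ : ℝ) :
    (cosh ξ * boostFactor ξ y ^ (-(α + 1))) ^ 2 * (1 - y ^ 2) * (1 - y ^ 2) ^ α ≤
      4 * boostWeight α ξ y := by
  have hE := boostFactor_pos hy ξ
  have ht : 0 < 1 - y ^ 2 := by nlinarith [hy.1, hy.2]
  have h1 : (boostFactor ξ y ^ (-(α + 1))) ^ 2 =
      boostFactor ξ y ^ (-(2 * α)) / boostFactor ξ y ^ 2 := by
    rw [← rpow_natCast, ← rpow_natCast, ← rpow_mul hE.le, ← rpow_sub hE]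
    congr 1
    push_cast
    ring
  have h2 : (1 - y ^ 2) ^ α = (1 - y ^ 2) ^ (α - 1) * (1 - y ^ 2) := by
    rw [← rpow_add_one ht.ne', sub_add_cancel]
  have h3 : (cosh ξ * (1 - y ^ 2)) ^ 2 ≤ (2 * boostFactor ξ y) ^ 2 :=
    pow_le_pow_left₀ (mul_nonneg (cosh_pos ξ).le ht.le) (cosh_mul_one_sub_sq_le hy ξ) 2
  have hw : 0 ≤ boostWeight α ξ y := mul_nonneg (rpow_nonneg ht.le _) (rpow_nonneg hE.le _)
  calc (cosh ξ * boostFactor ξ y ^ (-(α + 1))) ^ 2 * (1 - y ^ 2) * (1 - y ^ 2) ^ α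
      = (cosh ξ * (1 - y ^ 2)) ^ 2 / boostFactor ξ y ^ 2 * boostWeight α ξ y := by
        rw [mul_pow, h1, h2, boostWeight]
        ring
    _ ≤ 4 * boostWeight α ξ y := by
        refine mul_le_mul_of_nonneg_right ?_ hw
        rw [div_le_iff₀ (by positivity)]
        linarith

lemma energy_density_le {α y u v w K ξ₁ ξ₂ : ℝ} (hy : y ∈ Ioo (-1 : ℝ) 1)
    (hu : |u| ≤ K * (boostFactor ξ₁ y ^ (-α) + boostFactor ξ₂ y ^ (-α)))
    (hv : |v| ≤ K * (cosh ξ₁ * boostFactor ξ₁ y ^ (-(α + 1)) +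
      cosh ξ₂ * boostFactor ξ₂ y ^ (-(α + 1))))
    (hw : |w| ≤ K * (boostFactor ξ₁ y ^ (-α) + boostFactor ξ₂ y ^ (-α))) :
    (u ^ 2 + v ^ 2 * (1 - y ^ 2) + w ^ 2) * (1 - y ^ 2) ^ α ≤
      12 * K ^ 2 * (boostWeight α ξ₁ y + boostWeight α ξ₂ y) := by
  have ht : 0 < 1 - y ^ 2 := by nlinarith [hy.1, hy.2]
  have hsq {x a b : ℝ} (h : |x| ≤ K * (a + b)) : x ^ 2 ≤ 2 * K ^ 2 * (a ^ 2 + b ^ 2) := by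
    have h1 : x ^ 2 ≤ (K * (a + b)) ^ 2 := sq_le_sq' (abs_le.1 h).1 (abs_le.1 h).2
    nlinarith [mul_nonneg (sq_nonneg K) (sq_nonneg (a - b))]
  have a₁ := sq_boostFactor_rpow_mul_le (α := α) hy ξ₁
  have a₂ := sq_boostFactor_rpow_mul_le (α := α) hy ξ₂
  have b₁ := sq_cosh_mul_boostFactor_rpow_mul_le (α := α) hy ξ₁
  have b₂ := sq_cosh_mul_boostFactor_rpow_mul_le (α := α) hy ξ₂
  set A₁ := boostFactor ξ₁ y ^ (-α)
  set A₂ := boostFactor ξ₂ y ^ (-α)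
  set C₁ := cosh ξ₁ * boostFactor ξ₁ y ^ (-(α + 1))
  set C₂ := cosh ξ₂ * boostFactor ξ₂ y ^ (-(α + 1))
  have htα : 0 ≤ (1 - y ^ 2) ^ α := rpow_nonneg ht.le _
  calc (u ^ 2 + v ^ 2 * (1 - y ^ 2) + w ^ 2) * (1 - y ^ 2) ^ α
      ≤ (2 * K ^ 2 * (A₁ ^ 2 + A₂ ^ 2) + 2 * K ^ 2 * (C₁ ^ 2 + C₂ ^ 2) * (1 - y ^ 2) +
          2 * K ^ 2 * (A₁ ^ 2 + A₂ ^ 2)) * (1 - y ^ 2) ^ α := by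
        gcongr
        exacts [hsq hu, hsq hv, hsq hw]
    _ = 2 * K ^ 2 * (2 * (A₁ ^ 2 * (1 - y ^ 2) ^ α) + 2 * (A₂ ^ 2 * (1 - y ^ 2) ^ α) +
          C₁ ^ 2 * (1 - y ^ 2) * (1 - y ^ 2) ^ α + C₂ ^ 2 * (1 - y ^ 2) * (1 - y ^ 2) ^ α) := by
        ring
    _ ≤ 2 * K ^ 2 * (2 * boostWeight α ξ₁ y + 2 * boostWeight α ξ₂ y +
          4 * boostWeight α ξ₁ y + 4 * boostWeight α ξ₂ y) := by gcongr
    _ = _ := by ring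

lemma Hnorm_le_of_energy_density_le {p K ξ₁ ξ₂ : ℝ} (hp : 1 < p) (hK : 0 ≤ K)
    {q : (ℝ → ℝ) × (ℝ → ℝ)}
    (h : ∀ y ∈ Ioo (-1 : ℝ) 1,
      (q.1 y ^ 2 + deriv q.1 y ^ 2 * (1 - y ^ 2) + q.2 y ^ 2) * (1 - y ^ 2) ^ (2 / (p - 1)) ≤
        12 * K ^ 2 * (boostWeight (2 / (p - 1)) ξ₁ y + boostWeight (2 / (p - 1)) ξ₂ y)) :
    Hnorm p q ≤
      K * √(24 * ∫ y in Ioo (-1 : ℝ) 1, (1 - y ^ 2) ^ (2 / (p - 1) - 1)) := by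
  have hα : 0 < 2 / (p - 1) := div_pos two_pos (by linarith)
  obtain ⟨hi₁, hle₁⟩ := integrableOn_boostWeight hα ξ₁
  obtain ⟨hi₂, hle₂⟩ := integrableOn_boostWeight hα ξ₂
  set J := ∫ y in Ioo (-1 : ℝ) 1, (1 - y ^ 2) ^ (2 / (p - 1) - 1)
  have key : HnormSq p q ≤ K ^ 2 * (24 * J) := by
    rw [HnormSq, intervalIntegral.integral_of_le (by norm_num), integral_Ioc_eq_integral_Ioo]
    calc _ ≤ ∫ y in Ioo (-1 : ℝ) 1,
          12 * K ^ 2 * (boostWeight (2 / (p - 1)) ξ₁ y + boostWeight (2 / (p - 1)) ξ₂ y) := by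
          refine integral_mono_of_nonneg ?_ ((hi₁.add hi₂).const_mul _) ?_
          · filter_upwards [ae_restrict_mem measurableSet_Ioo] with y hy
            have ht : 0 < 1 - y ^ 2 := by nlinarith [hy.1, hy.2]
            have := rpow_nonneg ht.le (2 / (p - 1))
            simp only [Pi.zero_apply, rho]
            positivity
          · filter_upwards [ae_restrict_mem measurableSet_Ioo] with y hy
            exact h y hy
      _ = 12 * K ^ 2 * ((∫ y in Ioo (-1 : ℝ) 1, boostWeight (2 / (p - 1)) ξ₁ y) +
            ∫ y in Ioo (-1 : ℝ) 1, boostWeight (2 / (p - 1)) ξ₂ y) := by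
          rw [integral_const_mul, integral_add hi₁ hi₂]
      _ ≤ 12 * K ^ 2 * (J + J) := by gcongr
      _ = K ^ 2 * (24 * J) := by ring
  calc Hnorm p q ≤ √(K ^ 2 * (24 * J)) := sqrt_le_sqrt key
    _ = K * √(24 * J) := by rw [sqrt_mul (sq_nonneg K), sqrt_sq hK]

/-- Continuity of `κ*`. -/
theorem continuity_of_kappaStar (p : ℝ) (hp : 1 < p) :
    ∀ B : ℝ, 2 ≤ B → ∃ C : ℝ, 0 < C ∧
      ∀ d1 ν1 d2 ν2 : ℝ, |d1| < 1 → |d2| < 1 → -1 + |d1| < ν1 → -1 + |d2| < ν2 →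
        ν1 / (1 - |d1|) ∈ Set.Icc (-1 + 1 / B) B →
        ν2 / (1 - |d2|) ∈ Set.Icc (-1 + 1 / B) B →
        Hnorm p (pairSub (kappaStarPair p d1 ν1) (kappaStarPair p d2 ν2)) ≤
          C * (|ν1 / (1 - |d1|) - ν2 / (1 - |d2|)| + |arctanhR d1 - arctanhR d2|) := by
  intro B hB
  set α := 2 / (p - 1) with hαdef
  have hα : 0 < α := div_pos two_pos (by linarith)
  set J := ∫ y in Ioo (-1 : ℝ) 1, (1 - y ^ 2) ^ (α - 1) with hJ
  have hκ : 0 ≤ kappa0 p := by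
    unfold kappa0
    have : 0 ≤ p + 1 := by linarith
    positivity
  have hP := profileConst_nonneg hα hB
  refine ⟨kappa0 p * (1 + α) * profileConst α B * √(24 * J) + 1, by positivity, ?_⟩
  intro d1 ν1 d2 ν2 hd1 hd2 _ _ hμ1 hμ2
  have habs {μ : ℝ} (hμ : μ ∈ Set.Icc (-1 + 1 / B) B) : |μ| ≤ B := by
    have : 0 < 1 / B := by positivity
    exact abs_le.2 ⟨by linarith [hμ.1], hμ.2⟩
  set δ := |ν1 / (1 - |d1|) - ν2 / (1 - |d2|)| + |arctanhR d1 - arctanhR d2| with hδ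
  have hδ0 : 0 ≤ δ := by positivity
  set K := kappa0 p * (1 + α) * profileConst α B * δ with hK
  have hscale {c x S : ℝ} (hc : |c| ≤ kappa0 p * (1 + α)) (hx : |x| ≤ profileConst α B * δ * S) :
      |c * x| ≤ K * S := by
    rw [abs_mul]
    calc |c| * |x| ≤ kappa0 p * (1 + α) * (profileConst α B * δ * S) := by gcongr
      _ = K * S := by ring
  have hc1 : |kappa0 p| ≤ kappa0 p * (1 + α) := by
    rw [abs_of_nonneg hκ]
    nlinarith
  have hc2 : |-(α * kappa0 p)| ≤ kappa0 p * (1 + α) := by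
    rw [abs_neg, abs_of_nonneg (by positivity)]
    nlinarith
  have hle := Hnorm_le_of_energy_density_le (K := K) (ξ₁ := arctanhR d1) (ξ₂ := arctanhR d2)
    (q := pairSub (kappaStarPair p d1 ν1) (kappaStarPair p d2 ν2)) hp (by positivity) <| by
      intro y hy
      refine energy_density_le hy ?_ ?_ ?_
      · simp only [pairSub, kappaStarPair]
        rw [kappaStar1_eq hB hd1 hμ1.1 hy, kappaStar1_eq hB hd2 hμ2.1 hy, ← mul_sub]
        exact hscale hc1
          (abs_value_profile_sub_le hα hB hy hμ1.1 hμ2.1 (habs hμ2) _ _)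
      · have hderiv := ((hasDerivAt_kappaStar1 (p := p) hB hd1 hμ1.1 hy).sub
          (hasDerivAt_kappaStar1 (p := p) hB hd2 hμ2.1 hy)).deriv
        rw [← mul_sub] at hderiv
        exact (congrArg abs hderiv).trans_le (hscale hc2
          (abs_deriv_profile_sub_le hα hB hy hμ1.1 hμ2.1 (habs hμ2) _ _))
      · simp only [pairSub, kappaStarPair]
        rw [kappaStar2_eq hp hB hd1 hμ1.1 hy, kappaStar2_eq hp hB hd2 hμ2.1 hy, ← mul_sub]
        exact hscale hc2
          (abs_velocity_profile_sub_le hα hB hy hμ1.1 hμ2.1 (habs hμ1) (habs hμ2) _ _)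
  calc _ ≤ K * √(24 * J) := hle
    _ = kappa0 p * (1 + α) * profileConst α B * √(24 * J) * δ := by ring
    _ ≤ _ := by
      gcongr
      linarith
end
end

section
/- There exists C > 0 such that for all d ∈ (−1,1): ‖κ(d)‖_{𝓗₀} ≤ C, i.e. ∫_{−1}^{1}(κ(d,y)² + (∂_yκ(d,y))²(1−y²))ρ(y) dy is bounded uniformly in d. -/
noncomputable section

open Real MeasureTheory Set Filter Asymptotics

lemma one_add_mul_pos_of_mem {d y : ℝ} (hd : d ∈ Set.Ioo (-1 : ℝ) 1)
    (hy : y ∈ Set.Icc (-1 : ℝ) 1) : 0 < 1 + d * y := by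
  obtain ⟨h1, h2⟩ := hd
  obtain ⟨h3, h4⟩ := hy
  nlinarith [mul_nonneg (sub_nonneg.2 h2.le) (sub_nonneg.2 h4),
    mul_nonneg (sub_nonneg.2 h1.le) (sub_nonneg.2 h3)]

lemma one_sub_sq_mul_one_sub_sq_le (d y : ℝ) :
    (1 - d ^ 2) * (1 - y ^ 2) ≤ (1 + d * y) ^ 2 := by
  nlinarith [sq_nonneg (d + y)]

lemma one_sub_sq_le_two_mul {d y : ℝ} (hd : d ∈ Set.Ioo (-1 : ℝ) 1)
    (hy : y ∈ Set.Icc (-1 : ℝ) 1) : 1 - y ^ 2 ≤ 2 * (1 + d * y) := by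
  obtain ⟨h1, h2⟩ := hd
  obtain ⟨h3, h4⟩ := hy
  rcases le_total 0 y with h | h
  · nlinarith [mul_nonneg h (sub_nonneg.2 h1.le), sq_nonneg (1 - y)]
  · nlinarith [mul_nonneg (neg_nonneg.2 h) (sub_nonneg.2 h2.le), sq_nonneg (1 + y)]

lemma kappaSol_eq {p d y : ℝ} (hd : d ∈ Set.Ioo (-1 : ℝ) 1) (hu : 0 < 1 + d * y) :
    kappaSol p d y =
      kappa0 p * (1 - d ^ 2) ^ ((1 : ℝ) / (p - 1)) * (1 + d * y) ^ (-((2 : ℝ) / (p - 1))) := by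
  have hA : 0 ≤ 1 - d ^ 2 := by nlinarith [hd.1, hd.2]
  rw [kappaSol, Real.div_rpow hA (sq_nonneg _), ← Real.rpow_natCast (1 + d * y), ← Real.rpow_mul hu.le,
    Real.rpow_neg hu.le, mul_assoc, div_eq_mul_inv]
  congr 4
  push_cast
  ring

lemma hasDerivAt_one_add_mul_rpow {d y : ℝ} (r : ℝ) (hu : 0 < 1 + d * y) :
    HasDerivAt (fun z : ℝ => (1 + d * z) ^ r) (d * r * (1 + d * y) ^ (r - 1)) y := by
  have h : HasDerivAt (fun z : ℝ => 1 + d * z) d y := by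
    simpa using ((hasDerivAt_id y).const_mul d).const_add 1
  exact h.rpow_const (Or.inl hu.ne')

lemma deriv_kappaSol {p d y : ℝ} (hd : d ∈ Set.Ioo (-1 : ℝ) 1) (hu : 0 < 1 + d * y) :
    deriv (fun z => kappaSol p d z) y =
      kappa0 p * (1 - d ^ 2) ^ ((1 : ℝ) / (p - 1)) *
        (d * (-((2 : ℝ) / (p - 1))) * (1 + d * y) ^ (-((2 : ℝ) / (p - 1)) - 1)) := by
  have hev : (fun z => kappaSol p d z) =ᶠ[nhds y] fun z =>
      kappa0 p * (1 - d ^ 2) ^ ((1 : ℝ) / (p - 1)) * (1 + d * z) ^ (-((2 : ℝ) / (p - 1))) := by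
    have hc : ContinuousAt (fun z : ℝ => 1 + d * z) y := by fun_prop
    filter_upwards [hc.eventually (lt_mem_nhds hu)] with z hz
    exact kappaSol_eq hd hz
  rw [hev.deriv_eq]
  exact ((hasDerivAt_one_add_mul_rpow _ hu).const_mul _).deriv

lemma sq_rpow_one_div {x p : ℝ} (hx : 0 ≤ x) :
    (x ^ ((1 : ℝ) / (p - 1))) ^ 2 = x ^ ((2 : ℝ) / (p - 1)) := by
  rw [← Real.rpow_natCast, ← Real.rpow_mul hx]
  congr 1
  push_cast
  ring

lemma kappaSol_sq_mul_rho_le {p d y : ℝ} (hp : 1 < p) (hd : d ∈ Set.Ioo (-1 : ℝ) 1)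
    (hy : y ∈ Set.Icc (-1 : ℝ) 1) : kappaSol p d y ^ 2 * rho p y ≤ kappa0 p ^ 2 := by
  have hu := one_add_mul_pos_of_mem hd hy
  have hA : 0 ≤ 1 - d ^ 2 := by nlinarith [hd.1, hd.2]
  have hw : 0 ≤ 1 - y ^ 2 := by nlinarith [hy.1, hy.2]
  have hb : 0 < (2 : ℝ) / (p - 1) := div_pos two_pos (by linarith)
  have hQ : 0 ≤ (1 - d ^ 2) / (1 + d * y) ^ 2 := by positivity
  rw [kappaSol, rho, mul_pow, sq_rpow_one_div hQ, mul_assoc, ← Real.mul_rpow hQ hw]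
  refine mul_le_of_le_one_right (sq_nonneg _) (Real.rpow_le_one (by positivity) ?_ hb.le)
  rw [div_mul_eq_mul_div, div_le_one (by positivity)]
  exact one_sub_sq_mul_one_sub_sq_le d y

lemma deriv_kappaSol_sq_mul_rho_le {p d y : ℝ} (hp : 1 < p) (hd : d ∈ Set.Ioo (-1 : ℝ) 1)
    (hy : y ∈ Set.Icc (-1 : ℝ) 1) :
    deriv (fun z => kappaSol p d z) y ^ 2 * (1 - y ^ 2) * rho p y ≤
      kappa0 p ^ 2 * (2 / (p - 1)) ^ 2 * 2 ^ (2 / (p - 1) + 1) * d * (1 - d ^ 2) ^ (2 / (p - 1)) *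
        (d * (1 + d * y) ^ (-(2 / (p - 1)) - 1)) := by
  have hu := one_add_mul_pos_of_mem hd hy
  have hA : 0 ≤ 1 - d ^ 2 := by nlinarith [hd.1, hd.2]
  have hw : 0 ≤ 1 - y ^ 2 := by nlinarith [hy.1, hy.2]
  have hb : 0 < (2 : ℝ) / (p - 1) := div_pos two_pos (by linarith)
  rw [deriv_kappaSol hd hu, rho]
  have hsq := sq_rpow_one_div (p := p) hA
  set b : ℝ := 2 / (p - 1)
  have h1 : (1 - y ^ 2) * (1 - y ^ 2) ^ b = (1 - y ^ 2) ^ (b + 1) := by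
    rw [Real.rpow_add_one' hw (by positivity), mul_comm]
  have h2 : (1 - y ^ 2) ^ (b + 1) ≤ 2 ^ (b + 1) * (1 + d * y) ^ (b + 1) := by
    rw [← Real.mul_rpow zero_le_two hu.le]
    exact Real.rpow_le_rpow hw (one_sub_sq_le_two_mul hd hy) (by positivity)
  have h3 : (1 + d * y) ^ (b + 1) * (1 + d * y) ^ (-b - 1) = 1 := by
    rw [← Real.rpow_add hu]
    ring_nf
    exact Real.rpow_zero _
  set v := (1 + d * y) ^ (-b - 1)
  set K := kappa0 p
  set α := (1 - d ^ 2) ^ ((1 : ℝ) / (p - 1))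
  calc (K * α * (d * -b * v)) ^ 2 * (1 - y ^ 2) * (1 - y ^ 2) ^ b
      = (K * α * d * b * v) ^ 2 * ((1 - y ^ 2) * (1 - y ^ 2) ^ b) := by ring
    _ ≤ (K * α * d * b * v) ^ 2 * (2 ^ (b + 1) * (1 + d * y) ^ (b + 1)) := by
        rw [h1]
        gcongr
    _ = K ^ 2 * b ^ 2 * 2 ^ (b + 1) * d * α ^ 2 * (d * v) * ((1 + d * y) ^ (b + 1) * v) := by ring
    _ = _ := by rw [h3, hsq, mul_one]

lemma H0normSq_kappaSol_le {p d : ℝ} (hp : 1 < p) (hd : d ∈ Set.Ioo (-1 : ℝ) 1) :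
    H0normSq p (fun y => kappaSol p d y) ≤
      kappa0 p ^ 2 * (2 + 2 / (p - 1) * 2 ^ (2 / (p - 1) + 1) * 2 ^ (2 / (p - 1))) := by
  have hb : 0 < (2 : ℝ) / (p - 1) := div_pos two_pos (by linarith)
  have hm : 0 < 1 - d := by linarith [hd.2]
  have hq : 0 < 1 + d := by linarith [hd.1]
  have hA : 1 - d ^ 2 = (1 - d) * (1 + d) := by ring
  have hle : (-1 : ℝ) ≤ 1 := by norm_num
  have hder := fun y hy => deriv_kappaSol_sq_mul_rho_le (y := y) hp hd hy
  set b : ℝ := 2 / (p - 1)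
  set c : ℝ := kappa0 p ^ 2 * b ^ 2 * 2 ^ (b + 1) * d * (1 - d ^ 2) ^ b with hc
  have hcont : ContinuousOn
      (fun y : ℝ => kappa0 p ^ 2 + c * (d * (1 + d * y) ^ (-b - 1))) (Set.uIcc (-1) 1) := by
    rw [Set.uIcc_of_le hle]
    intro y hy
    exact (continuousAt_const.add (continuousAt_const.mul (continuousAt_const.mul
      (hasDerivAt_one_add_mul_rpow _
        (one_add_mul_pos_of_mem hd hy)).continuousAt))).continuousWithinAt
  have hint := hcont.intervalIntegrable (μ := volume)
  have hFTC : ∫ y in (-1 : ℝ)..1, (kappa0 p ^ 2 + c * (d * (1 + d * y) ^ (-b - 1))) =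
      2 * kappa0 p ^ 2 + c / b * ((1 - d) ^ (-b) - (1 + d) ^ (-b)) := by
    rw [intervalIntegral.integral_eq_sub_of_hasDerivAt
      (f := fun y => kappa0 p ^ 2 * y + -(c / b) * (1 + d * y) ^ (-b)) _ hint]
    · simp only [mul_one, mul_neg_one, ← sub_eq_add_neg]
      ring
    · intro y hy
      rw [Set.uIcc_of_le hle] at hy
      refine (((hasDerivAt_id y).const_mul (kappa0 p ^ 2)).add
        ((hasDerivAt_one_add_mul_rpow (-b) (one_add_mul_pos_of_mem hd hy)).const_mul
          (-(c / b)))).congr_deriv ?_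
      field_simp
  have hbound := intervalIntegral.norm_integral_le_of_norm_le hle
    (f := fun y => (kappaSol p d y ^ 2 + deriv (fun z => kappaSol p d z) y ^ 2 * (1 - y ^ 2)) *
      rho p y) (Filter.Eventually.of_forall fun y hy => ?_) hint
  · refine (le_abs_self _).trans (hbound.trans ?_)
    rw [hFTC, hc, hA, Real.mul_rpow hm.le hq.le, Real.rpow_neg hm.le, Real.rpow_neg hq.le]
    have hm' := Real.rpow_pos_of_pos hm b
    have hq' := Real.rpow_pos_of_pos hq b
    have hm2 : (1 - d) ^ b ≤ 2 ^ b := Real.rpow_le_rpow hm.le (by linarith [hd.1]) hb.le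
    have hq2 : (1 + d) ^ b ≤ 2 ^ b := Real.rpow_le_rpow hq.le (by linarith [hd.2]) hb.le
    have key : d * ((1 + d) ^ b - (1 - d) ^ b) ≤ 2 ^ b := by
      refine (le_abs_self _).trans ?_
      rw [abs_mul]
      have h1 : |d| ≤ 1 := abs_le.2 ⟨hd.1.le, hd.2.le⟩
      have h2 : |(1 + d) ^ b - (1 - d) ^ b| ≤ 2 ^ b :=
        abs_le.2 ⟨by linarith, by linarith⟩
      exact (mul_le_of_le_one_left (abs_nonneg _) h1).trans h2
    calc _ = kappa0 p ^ 2 * (2 + b * 2 ^ (b + 1) * (d * ((1 + d) ^ b - (1 - d) ^ b))) := by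
          field_simp
      _ ≤ _ := by gcongr
  · have hy' : y ∈ Set.Icc (-1 : ℝ) 1 := ⟨hy.1.le, hy.2⟩
    have hw : 0 ≤ 1 - y ^ 2 := by nlinarith [hy'.1, hy'.2]
    have hr : 0 ≤ rho p y := Real.rpow_nonneg hw _
    rw [Real.norm_of_nonneg (by positivity), add_mul]
    exact add_le_add (kappaSol_sq_mul_rho_le hp hd hy') (hder y hy')

/-- uniform bound on the solitons in `𝓗₀`. -/
theorem soliton_H0_bound (p : ℝ) (hp : 1 < p) :
    ∃ C : ℝ, 0 < C ∧ ∀ d ∈ Set.Ioo (-1 : ℝ) 1,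
      Real.sqrt (H0normSq p (fun y => kappaSol p d y)) ≤ C := by
  refine ⟨Real.sqrt (kappa0 p ^ 2 *
    (2 + 2 / (p - 1) * 2 ^ (2 / (p - 1) + 1) * 2 ^ (2 / (p - 1)))) + 1, by positivity,
    fun d hd => ?_⟩
  exact (Real.sqrt_le_sqrt (H0normSq_kappaSol_le hp hd)).trans (by linarith)
end
end

section
/- There exists C > 0 such that for all |d| < 1 and ν > −1+|d|: ‖κ*(d,ν)‖_𝓗 ≤ Cλ(d,ν) + C·1_{{ν<0}}·(|ν|/√(1−d²))·λ(d,ν)^{(p+1)/2}, where λ(d,ν) = (1−d²)^{1/(p−1)}/((1+ν)² − d²)^{1/(p−1)}. -/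
noncomputable section

open Real MeasureTheory Set Filter Asymptotics

/-! ### Elementary inequalities -/

lemma one_sub_sq_mul_sq_sub_sq_le (m d y : ℝ) :
    (1 - y ^ 2) * (m ^ 2 - d ^ 2) ≤ (m + d * y) ^ 2 := by
  nlinarith [sq_nonneg (d + m * y)]

lemma sub_abs_le_add_mul {m d y : ℝ} (hy : |y| ≤ 1) : m - |d| ≤ m + d * y := by
  have h : |d * y| ≤ |d| := by
    rw [abs_mul]; exact mul_le_of_le_one_right (abs_nonneg d) hy
  linarith [neg_abs_le (d * y)]

lemma mul_one_sub_sq_le {m d y : ℝ} (hd : |d| < m) :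
    m * (1 - y ^ 2) ≤ 2 * (m + d * y) := by
  have h : -(m * |y|) ≤ d * y := by
    have : |d * y| ≤ m * |y| := by
      rw [abs_mul]; exact mul_le_mul_of_nonneg_right hd.le (abs_nonneg y)
    linarith [neg_abs_le (d * y)]
  have hm : 0 < m := (abs_nonneg d).trans_lt hd
  have hsq : 0 ≤ m * (1 - |y|) ^ 2 := by positivity
  have habs : y ^ 2 = |y| ^ 2 := (sq_abs y).symm
  rw [habs]
  nlinarith

lemma mul_rpow_neg_le {m d s : ℝ} (hd : |d| < m) (hs : 0 ≤ s) :
    (m * (m - |d|)) ^ (-s) ≤ 2 ^ s * (m ^ 2 - d ^ 2) ^ (-s) := by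
  have hm : 0 < m := (abs_nonneg d).trans_lt hd
  have hδ : 0 < m - |d| := sub_pos.2 hd
  have hfac : m ^ 2 - d ^ 2 = (m - |d|) * (m + |d|) := by rw [← sq_abs d]; ring
  have hM : 0 < m ^ 2 - d ^ 2 := by rw [hfac]; positivity
  have hle : (m ^ 2 - d ^ 2) / 2 ≤ m * (m - |d|) := by rw [hfac]; nlinarith
  calc (m * (m - |d|)) ^ (-s) ≤ ((m ^ 2 - d ^ 2) / 2) ^ (-s) :=
        rpow_le_rpow_of_nonpos (by positivity) hle (by linarith)
    _ = 2 ^ s * (m ^ 2 - d ^ 2) ^ (-s) := by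
        rw [div_rpow hM.le (by norm_num), rpow_neg (by norm_num : (0 : ℝ) ≤ 2), div_inv_eq_mul,
          mul_comm]

/-! ### An integral of a negative power -/

lemma continuousOn_add_mul_rpow {m d : ℝ} (hd : |d| < m) (s : ℝ) :
    ContinuousOn (fun y : ℝ => (m + d * y) ^ s) (Icc (-1) 1) := by
  refine ContinuousOn.rpow_const (by fun_prop) fun y hy => Or.inl ?_
  exact ((sub_pos.2 hd).trans_le (sub_abs_le_add_mul (abs_le.2 hy))).ne'

lemma intervalIntegrable_add_mul_rpow {m d : ℝ} (hd : |d| < m) (s : ℝ) :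
    IntervalIntegrable (fun y : ℝ => (m + d * y) ^ s) volume (-1) 1 := by
  apply ContinuousOn.intervalIntegrable
  rw [uIcc_of_le (by norm_num)]
  exact continuousOn_add_mul_rpow hd s

lemma integral_add_mul_rpow_le {m d β : ℝ} (hd : |d| < m) (hβ : 0 < β) :
    m * ∫ y in (-1 : ℝ)..1, (m + d * y) ^ (-β - 1) ≤
      (2 + 2 * |β - 1|) / β * (m - |d|) ^ (-β) := by
  have hδ : 0 < m - |d| := sub_pos.2 hd
  have hpow : ∀ y : ℝ, |y| ≤ 1 → (m + d * y) ^ (-β) ≤ (m - |d|) ^ (-β) := fun y hy =>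
    rpow_le_rpow_of_nonpos hδ (sub_abs_le_add_mul hy) (by linarith)
  have hpow0 : ∀ y : ℝ, |y| ≤ 1 → 0 ≤ (m + d * y) ^ (-β) := fun y hy =>
    rpow_nonneg (hδ.le.trans (sub_abs_le_add_mul hy)) _
  have hderiv : ∀ y ∈ uIcc (-1 : ℝ) 1, HasDerivAt (fun y : ℝ => y * (m + d * y) ^ (-β))
      ((1 - β) * (m + d * y) ^ (-β) + β * m * (m + d * y) ^ (-β - 1)) y := by
    intro y hy
    rw [uIcc_of_le (by norm_num)] at hy
    have hu : 0 < m + d * y := hδ.trans_le (sub_abs_le_add_mul (abs_le.2 hy))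
    have h1 : HasDerivAt (fun y : ℝ => m + d * y) d y := by
      simpa using ((hasDerivAt_id y).const_mul d).const_add m
    have h2 := (hasDerivAt_id y).mul (h1.rpow_const (p := -β) (Or.inl hu.ne'))
    have h3 : (m + d * y) ^ (-β) = (m + d * y) ^ (-β - 1) * (m + d * y) := by
      rw [rpow_sub_one hu.ne', div_mul_cancel₀ _ hu.ne']
    refine h2.congr_deriv ?_
    rw [h3, id]; ring
  have i1 := intervalIntegrable_add_mul_rpow hd (-β)
  have i2 := intervalIntegrable_add_mul_rpow hd (-β - 1)
  have hftc := intervalIntegral.integral_eq_sub_of_hasDerivAt hderiv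
    ((i1.const_mul _).add (i2.const_mul _))
  rw [intervalIntegral.integral_add (i1.const_mul _) (i2.const_mul _),
    intervalIntegral.integral_const_mul, intervalIntegral.integral_const_mul] at hftc
  have hJ : ∫ y in (-1 : ℝ)..1, (m + d * y) ^ (-β) ≤ 2 * (m - |d|) ^ (-β) := by
    have := intervalIntegral.integral_mono_on (μ := volume) (by norm_num : (-1 : ℝ) ≤ 1) i1
      (intervalIntegrable_const (c := (m - |d|) ^ (-β))) fun y hy => hpow y (abs_le.2 hy)
    rw [intervalIntegral.integral_const] at this
    norm_num at this
    exact this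
  have hJ0 : 0 ≤ ∫ y in (-1 : ℝ)..1, (m + d * y) ^ (-β) :=
    intervalIntegral.integral_nonneg (by norm_num) fun y hy => hpow0 y (abs_le.2 hy)
  have e1 := hpow 1 (by simp)
  have e2 := hpow (-1) (by simp)
  have hJ' : (β - 1) * ∫ y in (-1 : ℝ)..1, (m + d * y) ^ (-β) ≤
      |β - 1| * (2 * (m - |d|) ^ (-β)) :=
    mul_le_mul (le_abs_self _) hJ hJ0 (abs_nonneg _)
  rw [div_mul_eq_mul_div, le_div_iff₀ hβ]
  linarith

/-! ### Pointwise bounds -/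

lemma one_sub_sq_rpow_div_le {m d y α : ℝ} (hd : |d| < m) (hy : |y| ≤ 1) (hα : 0 ≤ α) :
    (1 - y ^ 2) ^ α / ((m + d * y) ^ α) ^ 2 ≤ (m ^ 2 - d ^ 2) ^ (-α) := by
  have hu : 0 < m + d * y := (sub_pos.2 hd).trans_le (sub_abs_le_add_mul hy)
  have hW : 0 ≤ 1 - y ^ 2 := sub_nonneg.2 ((sq_le_one_iff_abs_le_one y).2 hy)
  have hM : 0 < m ^ 2 - d ^ 2 := sub_pos.2 (sq_lt_sq.2 (hd.trans_le (le_abs_self m)))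
  have h := rpow_le_rpow (by positivity) (one_sub_sq_mul_sq_sub_sq_le m d y) hα
  rw [mul_rpow hW hM.le, ← rpow_pow_comm hu.le] at h
  rw [rpow_neg hM.le, ← one_div, div_le_div_iff₀ (by positivity) (by positivity), one_mul]
  exact h

lemma one_sub_sq_rpow_le {m d y s : ℝ} (hd : |d| < m) (hy : |y| ≤ 1) (hs : 0 ≤ s) :
    (1 - y ^ 2) ^ s ≤ (2 / m) ^ s * (m + d * y) ^ s := by
  have hm : 0 < m := (abs_nonneg d).trans_lt hd
  have hu : 0 < m + d * y := (sub_pos.2 hd).trans_le (sub_abs_le_add_mul hy)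
  have hW : 0 ≤ 1 - y ^ 2 := sub_nonneg.2 ((sq_le_one_iff_abs_le_one y).2 hy)
  rw [← mul_rpow (by positivity) hu.le]
  refine rpow_le_rpow hW ?_ hs
  rw [div_mul_eq_mul_div, le_div_iff₀ hm, mul_comm]
  exact mul_one_sub_sq_le hd

/-! ### The three weighted integrals -/

lemma sq_mul_integral_le {m d α : ℝ} (hd : |d| < m) (hα : 0 < α) :
    d ^ 2 * ((2 / m) ^ (α + 1) * ∫ y in (-1 : ℝ)..1, (m + d * y) ^ (-α - 1)) ≤
      2 ^ (2 * α + 1) * ((2 + 2 * |α - 1|) / α) * (m ^ 2 - d ^ 2) ^ (-α) := by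
  have hm : 0 < m := (abs_nonneg d).trans_lt hd
  have hδ : 0 < m - |d| := sub_pos.2 hd
  have hI := integral_add_mul_rpow_le hd hα
  set J := ∫ y in (-1 : ℝ)..1, (m + d * y) ^ (-α - 1)
  have hJ0 : 0 ≤ J := intervalIntegral.integral_nonneg (by norm_num) fun y hy =>
    rpow_nonneg (hδ.le.trans (sub_abs_le_add_mul (abs_le.2 hy))) _
  have hd2 : d ^ 2 ≤ m ^ 2 := sq_le_sq.2 (hd.le.trans (le_abs_self m))
  calc d ^ 2 * ((2 / m) ^ (α + 1) * J) ≤ m ^ 2 * ((2 / m) ^ (α + 1) * J) := by gcongr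
    _ = 2 ^ (α + 1) * m ^ (-α) * (m * J) := by
        rw [div_rpow (by norm_num) hm.le, rpow_neg hm.le, rpow_add_one hm.ne']
        field_simp
    _ ≤ 2 ^ (α + 1) * m ^ (-α) * ((2 + 2 * |α - 1|) / α * (m - |d|) ^ (-α)) := by gcongr
    _ = 2 ^ (α + 1) * ((2 + 2 * |α - 1|) / α) * (m * (m - |d|)) ^ (-α) := by
        rw [mul_rpow hm.le hδ.le]; ring
    _ ≤ 2 ^ (α + 1) * ((2 + 2 * |α - 1|) / α) * (2 ^ α * (m ^ 2 - d ^ 2) ^ (-α)) := by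
        gcongr
        exact mul_rpow_neg_le hd hα.le
    _ = _ := by
        rw [show 2 * α + 1 = (α + 1) + α by ring, rpow_add two_pos (α + 1) α]; ring

lemma rpow_mul_integral_le {m d α : ℝ} (hd : |d| < m) (hα : 0 < α) :
    (2 / m) ^ α * ∫ y in (-1 : ℝ)..1, (m + d * y) ^ (-(α + 1) - 1) ≤
      2 ^ (2 * α + 1) * ((2 + 2 * α) / (α + 1)) * (m ^ 2 - d ^ 2) ^ (-(α + 1)) := by
  have hm : 0 < m := (abs_nonneg d).trans_lt hd
  have hδ : 0 < m - |d| := sub_pos.2 hd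
  have hI := integral_add_mul_rpow_le hd (by positivity : 0 < α + 1)
  rw [add_sub_cancel_right, abs_of_pos hα] at hI
  set J := ∫ y in (-1 : ℝ)..1, (m + d * y) ^ (-(α + 1) - 1)
  calc (2 / m) ^ α * J = 2 ^ α * m ^ (-(α + 1)) * (m * J) := by
        rw [div_rpow (by norm_num) hm.le, rpow_neg hm.le, rpow_add_one hm.ne']
        field_simp
    _ ≤ 2 ^ α * m ^ (-(α + 1)) * ((2 + 2 * α) / (α + 1) * (m - |d|) ^ (-(α + 1))) := by gcongr
    _ = 2 ^ α * ((2 + 2 * α) / (α + 1)) * (m * (m - |d|)) ^ (-(α + 1)) := by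
        rw [mul_rpow hm.le hδ.le]; ring
    _ ≤ 2 ^ α * ((2 + 2 * α) / (α + 1)) * (2 ^ (α + 1) * (m ^ 2 - d ^ 2) ^ (-(α + 1))) := by
        gcongr
        exact mul_rpow_neg_le hd (by positivity)
    _ = _ := by
        rw [show 2 * α + 1 = α + (α + 1) by ring, rpow_add two_pos α (α + 1)]; ring

/-! ### The generalized soliton -/

lemma kappa0_pos {p : ℝ} (hp : 1 < p) : 0 < kappa0 p := by
  have : 0 < p - 1 := sub_pos.2 hp
  unfold kappa0; positivity

lemma deriv_kappaStar1 {p d ν y : ℝ} (hu : 0 < 1 + d * y + ν) :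
    deriv (kappaStar1 p d ν) y =
      -(kappa0 p * (1 - d ^ 2) ^ ((1 : ℝ) / (p - 1)) * (2 / (p - 1)) * d) /
        ((1 + d * y + ν) ^ ((2 : ℝ) / (p - 1)) * (1 + d * y + ν)) := by
  have h1 : HasDerivAt (fun y : ℝ => 1 + d * y + ν) d y := by
    simpa using (((hasDerivAt_id y).const_mul d).const_add 1).add_const ν
  have hR : (0 : ℝ) < (1 + d * y + ν) ^ ((2 : ℝ) / (p - 1)) := rpow_pos_of_pos hu _
  have h2 := (hasDerivAt_const y (kappa0 p * (1 - d ^ 2) ^ ((1 : ℝ) / (p - 1)))).div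
    (h1.rpow_const (p := (2 : ℝ) / (p - 1)) (Or.inl hu.ne')) hR.ne'
  have h3 : deriv (kappaStar1 p d ν) y = _ := h2.deriv
  rw [h3, rpow_sub_one hu.ne']
  generalize (1 + d * y + ν) ^ ((2 : ℝ) / (p - 1)) = R at *
  generalize (2 : ℝ) / (p - 1) = α at *
  field_simp
  ring

lemma HnormSq_integrand_eq {p d ν y : ℝ} (hp : 1 < p) (hd : |d| < 1 + ν) (hy : |y| ≤ 1) :
    ((kappaStarPair p d ν).1 y ^ 2 + (deriv (kappaStarPair p d ν).1 y) ^ 2 * (1 - y ^ 2) +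
        (kappaStarPair p d ν).2 y ^ 2) * rho p y =
      (kappa0 p * (1 - d ^ 2) ^ ((1 : ℝ) / (p - 1))) ^ 2 *
        ((1 - y ^ 2) ^ ((2 : ℝ) / (p - 1)) / ((1 + ν + d * y) ^ ((2 : ℝ) / (p - 1))) ^ 2 +
          (2 / (p - 1)) ^ 2 * d ^ 2 * ((1 - y ^ 2) ^ ((2 : ℝ) / (p - 1) + 1) /
            ((1 + ν + d * y) ^ ((2 : ℝ) / (p - 1) + 1)) ^ 2) +
          (2 / (p - 1)) ^ 2 * ν ^ 2 * ((1 - y ^ 2) ^ ((2 : ℝ) / (p - 1)) /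
            ((1 + ν + d * y) ^ ((2 : ℝ) / (p - 1) + 1)) ^ 2)) := by
  have hp1 : 0 < p - 1 := sub_pos.2 hp
  have hα : (0 : ℝ) < 2 / (p - 1) := by positivity
  have hu : 0 < 1 + ν + d * y := (sub_pos.2 hd).trans_le (sub_abs_le_add_mul hy)
  have hu' : 1 + d * y + ν = 1 + ν + d * y := by ring
  have hW : 0 ≤ 1 - y ^ 2 := sub_nonneg.2 ((sq_le_one_iff_abs_le_one y).2 hy)
  have hexp : (p + 1) / (p - 1) = 2 / (p - 1) + 1 := by field_simp; ring
  have hWs : (1 - y ^ 2) ^ ((2 : ℝ) / (p - 1) + 1) =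
      (1 - y ^ 2) ^ ((2 : ℝ) / (p - 1)) * (1 - y ^ 2) := by
    rw [rpow_add_of_nonneg hW hα.le zero_le_one, rpow_one]
  have hfst : deriv (kappaStarPair p d ν).1 y = deriv (kappaStar1 p d ν) y := rfl
  rw [hfst, deriv_kappaStar1 (hu' ▸ hu)]
  simp only [kappaStarPair, kappaStar1, kappaStar2, rho, hexp, hu', hWs, rpow_add_one hu.ne']
  have hR := rpow_pos_of_pos hu ((2 : ℝ) / (p - 1))
  generalize (1 - y ^ 2) ^ ((2 : ℝ) / (p - 1)) = w
  generalize (1 + ν + d * y) ^ ((2 : ℝ) / (p - 1)) = R at *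
  field_simp

lemma HnormSq_kappaStarPair_le {p d ν : ℝ} (hp : 1 < p) (hd1 : |d| < 1) (hd : |d| < 1 + ν) :
    HnormSq p (kappaStarPair p d ν) ≤
      (kappa0 p * (1 - d ^ 2) ^ ((1 : ℝ) / (p - 1))) ^ 2 *
        (2 * (1 + (2 / (p - 1)) ^ 2) * ((1 + ν) ^ 2 - d ^ 2) ^ (-((2 : ℝ) / (p - 1))) +
          (2 / (p - 1)) ^ 2 * (d ^ 2 * ((2 / (1 + ν)) ^ ((2 : ℝ) / (p - 1) + 1) *
            ∫ y in (-1 : ℝ)..1, (1 + ν + d * y) ^ (-((2 : ℝ) / (p - 1)) - 1))) +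
          (2 / (p - 1)) ^ 2 * (if ν < 0 then ν ^ 2 else 0) *
            ((2 / (1 + ν)) ^ ((2 : ℝ) / (p - 1)) *
              ∫ y in (-1 : ℝ)..1, (1 + ν + d * y) ^ (-((2 : ℝ) / (p - 1) + 1) - 1))) := by
  have hp1 : 0 < p - 1 := sub_pos.2 hp
  unfold HnormSq
  set A := (kappa0 p * (1 - d ^ 2) ^ ((1 : ℝ) / (p - 1))) ^ 2
  have hA : 0 ≤ A := sq_nonneg _
  have hpt := fun (y : ℝ) (hy : |y| ≤ 1) => HnormSq_integrand_eq hp hd hy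
  rw [intervalIntegral.integral_congr (fun y hy => hpt y (abs_le.2 (by
    rwa [uIcc_of_le (by norm_num)] at hy)))]
  rw [intervalIntegral.integral_const_mul]
  have hα : (0 : ℝ) < 2 / (p - 1) := by positivity
  generalize (2 : ℝ) / (p - 1) = α at *
  set m := 1 + ν with hm_def
  have hδ : 0 < m - |d| := sub_pos.2 hd
  have hm : 0 < m := (abs_nonneg d).trans_lt hd
  have hu : ∀ y : ℝ, |y| ≤ 1 → 0 < m + d * y := fun y hy => hδ.trans_le (sub_abs_le_add_mul hy)
  have hM : 0 < m ^ 2 - d ^ 2 := sub_pos.2 (sq_lt_sq.2 (hd.trans_le (le_abs_self m)))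
  refine mul_le_mul_of_nonneg_left ?_ hA
  have i1 := intervalIntegrable_add_mul_rpow hd (-α - 1)
  have i2 := intervalIntegrable_add_mul_rpow hd (-(α + 1) - 1)
  set N := if ν < 0 then ν ^ 2 else 0 with hN
  have j0 : IntervalIntegrable (fun _ : ℝ => (1 + α ^ 2) * (m ^ 2 - d ^ 2) ^ (-α))
    volume (-1) 1 := intervalIntegrable_const
  have j1 := i1.const_mul (α ^ 2 * d ^ 2 * (2 / m) ^ (α + 1))
  have j2 := i2.const_mul (α ^ 2 * N * (2 / m) ^ α)
  have hbound : ∀ y : ℝ, |y| ≤ 1 →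
      (1 - y ^ 2) ^ α / ((m + d * y) ^ α) ^ 2 +
          α ^ 2 * d ^ 2 * ((1 - y ^ 2) ^ (α + 1) / ((m + d * y) ^ (α + 1)) ^ 2) +
          α ^ 2 * ν ^ 2 * ((1 - y ^ 2) ^ α / ((m + d * y) ^ (α + 1)) ^ 2) ≤
        (1 + α ^ 2) * (m ^ 2 - d ^ 2) ^ (-α) +
          α ^ 2 * d ^ 2 * (2 / m) ^ (α + 1) * (m + d * y) ^ (-α - 1) +
          α ^ 2 * N * (2 / m) ^ α * (m + d * y) ^ (-(α + 1) - 1) := by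
    intro y hy
    have hu := hu y hy
    have b1 := one_sub_sq_rpow_div_le hd hy hα.le
    have b2 : (1 - y ^ 2) ^ (α + 1) / ((m + d * y) ^ (α + 1)) ^ 2 ≤
        (2 / m) ^ (α + 1) * (m + d * y) ^ (-α - 1) := by
      rw [show -α - 1 = -(α + 1) by ring, rpow_neg hu.le, div_le_iff₀ (by positivity)]
      refine (one_sub_sq_rpow_le hd hy (by positivity)).trans_eq ?_
      have := rpow_pos_of_pos hu (α + 1)
      field_simp
    have hMα := rpow_pos_of_pos hM (-α)
    have b3 : ν ^ 2 * ((1 - y ^ 2) ^ α / ((m + d * y) ^ (α + 1)) ^ 2) ≤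
        (m ^ 2 - d ^ 2) ^ (-α) + N * ((2 / m) ^ α * (m + d * y) ^ (-(α + 1) - 1)) := by
      have hR := rpow_pos_of_pos hu α
      by_cases hν : ν < 0
      · rw [hN, if_pos hν]
        have : (1 - y ^ 2) ^ α / ((m + d * y) ^ (α + 1)) ^ 2 ≤
            (2 / m) ^ α * (m + d * y) ^ (-(α + 1) - 1) := by
          rw [rpow_sub_one hu.ne', rpow_neg hu.le, rpow_add_one hu.ne',
            div_le_iff₀ (by positivity)]
          refine (one_sub_sq_rpow_le hd hy hα.le).trans_eq ?_
          field_simp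
        have := mul_le_mul_of_nonneg_left this (sq_nonneg ν)
        linarith
      · rw [hN, if_neg hν, zero_mul, add_zero]
        refine le_trans ?_ b1
        have hνu : ν ≤ m + d * y := by
          have := sub_abs_le_add_mul (m := m) (d := d) hy
          linarith
        have hsq : ν ^ 2 ≤ (m + d * y) ^ 2 := pow_le_pow_left₀ (not_lt.1 hν) hνu 2
        have hW : 0 ≤ 1 - y ^ 2 := sub_nonneg.2 ((sq_le_one_iff_abs_le_one y).2 hy)
        calc ν ^ 2 * ((1 - y ^ 2) ^ α / ((m + d * y) ^ (α + 1)) ^ 2)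
            ≤ (m + d * y) ^ 2 * ((1 - y ^ 2) ^ α / ((m + d * y) ^ (α + 1)) ^ 2) := by gcongr
          _ = _ := by
              rw [rpow_add_one hu.ne']
              field_simp
    have b2' := mul_le_mul_of_nonneg_left b2 (by positivity : 0 ≤ α ^ 2 * d ^ 2)
    have b3' := mul_le_mul_of_nonneg_left b3 (by positivity : 0 ≤ α ^ 2)
    linarith
  have hmono : (∫ y in (-1 : ℝ)..1, ((1 - y ^ 2) ^ α / ((m + d * y) ^ α) ^ 2 +
          α ^ 2 * d ^ 2 * ((1 - y ^ 2) ^ (α + 1) / ((m + d * y) ^ (α + 1)) ^ 2) +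
          α ^ 2 * ν ^ 2 * ((1 - y ^ 2) ^ α / ((m + d * y) ^ (α + 1)) ^ 2))) ≤
      ∫ y in (-1 : ℝ)..1, ((1 + α ^ 2) * (m ^ 2 - d ^ 2) ^ (-α) +
          α ^ 2 * d ^ 2 * (2 / m) ^ (α + 1) * (m + d * y) ^ (-α - 1) +
          α ^ 2 * N * (2 / m) ^ α * (m + d * y) ^ (-(α + 1) - 1)) := by
    refine intervalIntegral.integral_mono_on (by norm_num) ?_ ((j0.add j1).add j2)
      fun y hy => hbound y (abs_le.2 hy)
    apply ContinuousOn.intervalIntegrable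
    rw [uIcc_of_le (by norm_num)]
    have hne : ∀ s : ℝ, ∀ y ∈ Icc (-1 : ℝ) 1, ((m + d * y) ^ s) ^ 2 ≠ 0 := fun s y hy =>
      (pow_pos (rpow_pos_of_pos (hu y (abs_le.2 hy)) s) 2).ne'
    have hW : ∀ s : ℝ, 0 ≤ s → ContinuousOn (fun y : ℝ => (1 - y ^ 2) ^ s) (Icc (-1) 1) :=
      fun s hs => ContinuousOn.rpow_const (by fun_prop) fun y _ => Or.inr hs
    have hdiv : ∀ s t : ℝ, 0 ≤ s →
        ContinuousOn (fun y : ℝ => (1 - y ^ 2) ^ s / ((m + d * y) ^ t) ^ 2) (Icc (-1) 1) :=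
      fun s t hs => (hW s hs).div ((continuousOn_add_mul_rpow hd t).pow 2) (hne t)
    exact ((hdiv _ _ hα.le).add ((hdiv _ _ (by positivity)).const_mul _)).add
      ((hdiv _ _ hα.le).const_mul _)
  refine hmono.trans_eq ?_
  rw [intervalIntegral.integral_add (j0.add j1) j2, intervalIntegral.integral_add j0 j1,
    intervalIntegral.integral_const, intervalIntegral.integral_const_mul,
    intervalIntegral.integral_const_mul, smul_eq_mul]
  ring

lemma lamFun_sq {p d ν : ℝ} (hd : |d| < 1 + ν) :
    lamFun p d ν ^ 2 = ((1 - d ^ 2) ^ ((1 : ℝ) / (p - 1))) ^ 2 *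
      ((1 + ν) ^ 2 - d ^ 2) ^ (-((2 : ℝ) / (p - 1))) := by
  have hM : 0 < (1 + ν) ^ 2 - d ^ 2 := sub_pos.2 (sq_lt_sq.2 (hd.trans_le (le_abs_self _)))
  have h : ((1 + ν) ^ 2 - d ^ 2) ^ ((2 : ℝ) / (p - 1)) =
      (((1 + ν) ^ 2 - d ^ 2) ^ ((1 : ℝ) / (p - 1))) ^ 2 := by
    rw [← rpow_mul_natCast hM.le]
    congr 1
    push_cast
    ring
  rw [lamFun, rpow_neg hM.le, h, div_pow, div_eq_mul_inv]

lemma lamFun_rpow_sq {p d ν : ℝ} (hp : 1 < p) (hd1 : |d| < 1) (hd : |d| < 1 + ν) :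
    (|ν| / √(1 - d ^ 2) * lamFun p d ν ^ ((p + 1) / 2)) ^ 2 =
      ((1 - d ^ 2) ^ ((1 : ℝ) / (p - 1))) ^ 2 *
        (ν ^ 2 * ((1 + ν) ^ 2 - d ^ 2) ^ (-((2 : ℝ) / (p - 1) + 1))) := by
  have hp1 : 0 < p - 1 := sub_pos.2 hp
  have hM : 0 < (1 + ν) ^ 2 - d ^ 2 := sub_pos.2 (sq_lt_sq.2 (hd.trans_le (le_abs_self _)))
  have hD : 0 < 1 - d ^ 2 := sub_pos.2 ((sq_lt_one_iff_abs_lt_one d).2 hd1)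
  have hl : 0 < lamFun p d ν := by unfold lamFun; positivity
  have h1 : (lamFun p d ν ^ ((p + 1) / 2)) ^ 2 = lamFun p d ν ^ 2 * lamFun p d ν ^ (p - 1) := by
    rw [← rpow_natCast, ← rpow_mul hl.le, ← rpow_natCast, ← rpow_add hl]
    congr 1
    push_cast
    ring
  have h2 : lamFun p d ν ^ (p - 1) = (1 - d ^ 2) / ((1 + ν) ^ 2 - d ^ 2) := by
    rw [lamFun, div_rpow (by positivity) (by positivity), ← rpow_mul hD.le, ← rpow_mul hM.le,
      one_div_mul_cancel hp1.ne', rpow_one, rpow_one]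
  rw [mul_pow, div_pow, sq_abs, sq_sqrt hD.le, h1, h2, lamFun_sq hd, neg_add,
    ← sub_eq_add_neg, rpow_sub_one hM.ne']
  field_simp

/-- bound on the generalized solitons in `𝓗`. -/
theorem kappaStar_H_bound (p : ℝ) (hp : 1 < p) :
    ∃ C : ℝ, 0 < C ∧ ∀ d ν : ℝ, |d| < 1 → -1 + |d| < ν →
      Hnorm p (kappaStarPair p d ν) ≤
        C * lamFun p d ν +
          C * (if ν < 0 then |ν| / Real.sqrt (1 - d ^ 2) * lamFun p d ν ^ ((p + 1) / 2)
            else 0) := by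
  have hp1 : 0 < p - 1 := sub_pos.2 hp
  have hα : (0 : ℝ) < 2 / (p - 1) := by positivity
  have hκ := kappa0_pos hp
  set α : ℝ := 2 / (p - 1) with hα_def
  set C₁ : ℝ := 2 * (1 + α ^ 2) + α ^ 2 * (2 ^ (2 * α + 1) * ((2 + 2 * |α - 1|) / α)) with hC₁
  set C₂ : ℝ := α ^ 2 * (2 ^ (2 * α + 1) * ((2 + 2 * α) / (α + 1))) with hC₂
  have hC₁0 : 0 < C₁ := by positivity
  have hC₂0 : 0 < C₂ := by positivity
  refine ⟨√(kappa0 p ^ 2 * (C₁ + C₂)), by positivity, fun d ν hd1 hν => ?_⟩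
  have hd : |d| < 1 + ν := by linarith
  have hM : 0 < (1 + ν) ^ 2 - d ^ 2 := sub_pos.2 (sq_lt_sq.2 (hd.trans_le (le_abs_self _)))
  have hD : 0 < 1 - d ^ 2 := sub_pos.2 ((sq_lt_one_iff_abs_lt_one d).2 hd1)
  have hl : 0 < lamFun p d ν := by unfold lamFun; positivity
  set b : ℝ := if ν < 0 then |ν| / √(1 - d ^ 2) * lamFun p d ν ^ ((p + 1) / 2) else 0 with hb
  have hb0 : 0 ≤ b := by rw [hb]; split_ifs <;> positivity
  have hb2 : b ^ 2 = ((1 - d ^ 2) ^ ((1 : ℝ) / (p - 1))) ^ 2 *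
      ((if ν < 0 then ν ^ 2 else 0) * ((1 + ν) ^ 2 - d ^ 2) ^ (-(α + 1))) := by
    rw [hb]
    split_ifs
    · exact lamFun_rpow_sq hp hd1 hd
    · simp
  have hl2 : lamFun p d ν ^ 2 =
      ((1 - d ^ 2) ^ ((1 : ℝ) / (p - 1))) ^ 2 * ((1 + ν) ^ 2 - d ^ 2) ^ (-α) :=
    lamFun_sq hd
  have hN : 0 ≤ if ν < 0 then ν ^ 2 else 0 := by split_ifs <;> positivity
  have key : HnormSq p (kappaStarPair p d ν) ≤
      kappa0 p ^ 2 * (C₁ * lamFun p d ν ^ 2 + C₂ * b ^ 2) := by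
    refine (HnormSq_kappaStarPair_le hp hd1 hd).trans ?_
    rw [← hα_def, hl2, hb2]
    have h1 := mul_le_mul_of_nonneg_left (sq_mul_integral_le hd hα) (sq_nonneg α)
    have h2 := mul_le_mul_of_nonneg_left (rpow_mul_integral_le hd hα)
      (mul_nonneg (sq_nonneg α) hN)
    have h3 := add_le_add (add_le_add
      (le_refl (2 * (1 + α ^ 2) * ((1 + ν) ^ 2 - d ^ 2) ^ (-α))) h1) h2
    refine (mul_le_mul_of_nonneg_left h3 (sq_nonneg _)).trans_eq ?_
    rw [hC₁, hC₂]
    ring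
  rw [Hnorm, ← mul_add, ← sqrt_sq (add_nonneg hl.le hb0), ← sqrt_mul (by positivity)]
  refine sqrt_le_sqrt (key.trans ?_)
  have h3 : lamFun p d ν ^ 2 ≤ (lamFun p d ν + b) ^ 2 := by gcongr; linarith
  have h4 : b ^ 2 ≤ (lamFun p d ν + b) ^ 2 := by gcongr; linarith
  calc kappa0 p ^ 2 * (C₁ * lamFun p d ν ^ 2 + C₂ * b ^ 2)
      ≤ kappa0 p ^ 2 * (C₁ * (lamFun p d ν + b) ^ 2 + C₂ * (lamFun p d ν + b) ^ 2) := by gcongr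
    _ = kappa0 p ^ 2 * (C₁ + C₂) * (lamFun p d ν + b) ^ 2 := by ring
end
end
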